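/- arXiv:1703.05559 — 3 statements merged into one kernel-verified Lean document; each statement's English description precedes it below -/
import Mathlib

section
/- Let n ≥ 3 and 2 ≤ k ≤ n. If f : [k] → [n] is strictly increasing and M is a valid connection k-pattern, then (E(H) \ E⁻_f) ∪ E⁺_{(f,M)} is the edge set of a Hamiltonian cycle of G; in particular, the pair (E⁻_f, E⁺_{(f,M)}) is a k-move. -/
/-!
Setup: `G` is the complete graph on the vertex set `Fin n` (0-indexed version of
`w_1, …, w_n`), and `H` is the Hamiltonian tour visiting the vertices in this order,
with edges `e_i = {w_i, w_{i+1}}` (cyclically).  The vertex `i` is the left endpoint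
of `e_i` and `i+1 (mod n)` its right endpoint.
-/

/-- The `i`-th edge of the reference tour `H`: `{w_i, w_{i+1}}` (cyclically). -/
def tourEdge (n : ℕ) (i : Fin n) : Sym2 (Fin n) :=
  s(i, ⟨(i.val + 1) % n, Nat.mod_lt _ (by have := i.isLt; omega)⟩)

/-- The edge set of the reference Hamiltonian tour `H`. -/
def tourEdgeSet (n : ℕ) : Set (Sym2 (Fin n)) := Set.range (tourEdge n)

/-- `E` is the edge set of a Hamiltonian cycle (of the complete graph on `V`). -/
def IsHamCycleEdgeSet {V : Type*} [Fintype V] [DecidableEq V] (E : Set (Sym2 V)) : Prop :=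
  ∃ (u : V) (p : (SimpleGraph.fromEdgeSet E).Walk u u),
    p.IsHamiltonianCycle ∧ ∀ e, e ∈ E ↔ e ∈ p.edges

/-- `(Em, Ep)` is a `k`-move: both sets have `k` elements, `Em` consists of tour
edges, `Ep` consists of edges of the complete graph, and replacing `Em` by `Ep`
in the tour yields (the edge set of) a Hamiltonian cycle. -/
def IsKMove (n k : ℕ) (Em Ep : Set (Sym2 (Fin n))) : Prop :=
  Em.ncard = k ∧ Ep.ncard = k ∧ Em ⊆ tourEdgeSet n ∧ (∀ e ∈ Ep, ¬ e.IsDiag) ∧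
    IsHamCycleEdgeSet ((tourEdgeSet n \ Em) ∪ Ep)

/-- A perfect matching on the vertex set `V`, given by its edge set: there are no
loops and every vertex lies on exactly one edge. -/
def IsPerfectMatchingEdgeSet {V : Type*} (M : Set (Sym2 V)) : Prop :=
  (∀ e ∈ M, ¬ e.IsDiag) ∧ ∀ v : V, ∃! e, e ∈ M ∧ v ∈ e

/-- The identification pairs used in the definition of a *valid* connection pattern:
(1-indexed) vertex `2i` is identified with vertex `(2i+1) mod 2k`, i.e. (0-indexed)
`2j+1` is paired with `2j+2 (mod 2k)` for `j = 0, …, k-1`. -/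
def nuEdges (k : ℕ) : Set (Sym2 (Fin (2 * k))) :=
  { e | ∃ j : Fin k,
      e = s((⟨(2 * j.val + 1) % (2 * k), Nat.mod_lt _ (by have := j.isLt; omega)⟩ : Fin (2 * k)),
            (⟨(2 * j.val + 2) % (2 * k), Nat.mod_lt _ (by have := j.isLt; omega)⟩ : Fin (2 * k))) }

/-- A valid connection `k`-pattern: a perfect matching `M` on `[2k]` such that
identifying vertex `2i` with vertex `(2i+1) mod 2k` for every `i` turns `M` into a
single cycle of length `k`; equivalently, the union of `M` with the identification
pairs is a connected graph on `[2k]`. -/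
def IsValidPattern (k : ℕ) (M : Set (Sym2 (Fin (2 * k)))) : Prop :=
  IsPerfectMatchingEdgeSet M ∧ (SimpleGraph.fromEdgeSet (M ∪ nuEdges k)).Connected

/-- The endpoints `v_1, …, v_{2k}` (0-indexed: `v_{2j}` is the left endpoint of
`e_{f(j)}` and `v_{2j+1}` its right endpoint). -/
def endpointMap (n k : ℕ) (f : Fin k → Fin n) : Fin (2 * k) → Fin n :=
  fun p =>
    if p.val % 2 = 0 then f ⟨p.val / 2, by have := p.isLt; omega⟩
    else ⟨((f ⟨p.val / 2, by have := p.isLt; omega⟩).val + 1) % n,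
          Nat.mod_lt _ (by have := (f ⟨p.val / 2, by have := p.isLt; omega⟩).isLt; omega)⟩

/-- `E⁻_f`, the set of removed tour edges. -/
def EminusSet (n k : ℕ) (f : Fin k → Fin n) : Set (Sym2 (Fin n)) :=
  { e | ∃ j : Fin k, e = tourEdge n (f j) }

/-- `E⁺_{(f,M)}`, the set of added edges `{v_i, v_j}` for `{i,j} ∈ M`. -/
def EplusSet (n k : ℕ) (f : Fin k → Fin n) (M : Set (Sym2 (Fin (2 * k)))) :
    Set (Sym2 (Fin n)) :=
  (Sym2.map (endpointMap n k f)) '' M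

open SimpleGraph in
/-- A loopless edge set spanning a connected graph in which every vertex has two neighbours is the
edge set of a Hamiltonian cycle. -/
theorem isHamCycleEdgeSet_of_connected {V : Type*} [Fintype V] [DecidableEq V]
    {E : Set (Sym2 V)} (hdiag : ∀ e ∈ E, ¬ e.IsDiag)
    (hconn : (fromEdgeSet E).Connected)
    (hdeg : ∀ v, ((fromEdgeSet E).neighborSet v).ncard = 2) : IsHamCycleEdgeSet E := by
  obtain ⟨u⟩ := hconn.nonempty
  have hne : ∀ v, ((fromEdgeSet E).neighborSet v).Nonempty := fun v =>
    (Set.ncard_pos).1 (by rw [hdeg]; norm_num)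
  have hcyc : (fromEdgeSet E).IsCycles := fun v _ => hdeg v
  obtain ⟨p, hp, hverts⟩ := hcyc.exists_cycle_toSubgraph_verts_eq_connectedComponentSupp
    (c := (fromEdgeSet E).connectedComponentMk u) (v := u) rfl (hne u)
  have hsupp : ∀ v, v ∈ p.support := by
    intro v
    rw [← Walk.mem_verts_toSubgraph, hverts]
    exact ConnectedComponent.sound (hconn.preconnected v u)
  refine ⟨u, p, ?_, ?_⟩
  · rw [Walk.isHamiltonianCycle_iff_isCycle_and_support_count_tail_eq_one]
    refine ⟨hp, fun v => List.count_eq_one_of_mem hp.support_nodup ?_⟩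
    rcases Walk.mem_support_iff p |>.1 (hsupp v) with rfl | h
    · exact Walk.end_mem_tail_support hp.not_nil
    · exact h
  · intro e
    induction e using Sym2.ind with
    | _ a b =>
      constructor
      · intro hab
        have hsub : p.toSubgraph.neighborSet a = (fromEdgeSet E).neighborSet a :=
          Set.eq_of_subset_of_ncard_le (p.toSubgraph.neighborSet_subset a)
            (by rw [hdeg, hp.ncard_neighborSet_toSubgraph_eq_two (hsupp a)])
        have hb : b ∈ p.toSubgraph.neighborSet a := by
          rw [hsub]
          exact (fromEdgeSet_adj E).2 ⟨hab, fun h => hdiag _ hab h⟩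
        rw [← Walk.mem_edges_toSubgraph]
        exact hb
      · intro hab
        exact ((fromEdgeSet_adj E).1 (p.adj_of_mem_edges hab)).1

/-- An arrangement of ports: every vertex of `V` has exactly two ports, exchanged by `nu`,
the ports are matched by `m`, and no proper nonempty set of ports is stable under both. -/
structure PortSystem {V P : Type*} (π : P → V) (m nu : P → P) : Prop where
  surj : Function.Surjective π
  match_invol : Function.Involutive m
  match_ne : ∀ p, m p ≠ p
  twin_ne : ∀ p, nu p ≠ p
  proj_eq : ∀ p q, π p = π q ↔ q = p ∨ q = nu p
  conn : ∀ S : P → Prop, (∀ p, S (m p) ↔ S p) → (∀ p, S (nu p) ↔ S p) → ∀ p q, S p → S q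

namespace PortSystem

variable {V P : Type*} {π : P → V} {m nu : P → P}

theorem proj_twin (h : PortSystem π m nu) (p : P) : π (nu p) = π p :=
  ((h.proj_eq p (nu p)).2 (Or.inr rfl)).symm

theorem match_twin_ne [Fintype V] (h : PortSystem π m nu) (hV : 3 ≤ Fintype.card V) (p : P) :
    m (nu p) ≠ nu (m p) := by
  classical
  intro hp
  have hclosed : ∀ x, (π x = π p ∨ π x = π (m p)) → (π (m x) = π p ∨ π (m x) = π (m p)) := by
    rintro x (hx | hx)
    · rcases (h.proj_eq p x).1 hx.symm with rfl | rfl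
      · exact Or.inr rfl
      · rw [hp, h.proj_twin]
        exact Or.inr rfl
    · rcases (h.proj_eq (m p) x).1 hx.symm with rfl | rfl
      · rw [h.match_invol]
        exact Or.inl rfl
      · rw [← hp, h.match_invol, h.proj_twin]
        exact Or.inl rfl
  have hall := h.conn (fun x => π x = π p ∨ π x = π (m p))
    (fun x => ⟨fun hx => by simpa only [h.match_invol x] using hclosed _ hx, hclosed x⟩)
    (fun x => by rw [h.proj_twin]) p
  have hsub : (Finset.univ : Finset V) ⊆ {π p, π (m p)} := by
    intro v _
    obtain ⟨x, rfl⟩ := h.surj v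
    simpa using hall x (Or.inl rfl)
  have := (Finset.card_le_card hsub).trans Finset.card_le_two
  rw [Finset.card_univ] at this
  omega

theorem proj_match_ne [Fintype V] (h : PortSystem π m nu) (hV : 3 ≤ Fintype.card V) (p : P) :
    π p ≠ π (m p) := by
  intro hp
  rcases (h.proj_eq _ _).1 hp with h1 | h1
  · exact h.match_ne p h1
  · rcases (h.proj_eq (nu p) p).1 (h.proj_twin p) with h2 | h2
    · exact h.twin_ne p h2.symm
    · exact h.match_twin_ne hV p (by rw [h1, ← h2, ← h1, h.match_invol])

theorem edge_inj [Fintype V] (h : PortSystem π m nu) (hV : 3 ≤ Fintype.card V) {p q : P}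
    (hpq : s(π p, π (m p)) = s(π q, π (m q))) : q = p ∨ q = m p := by
  have key : ∀ q, π p = π q → π (m p) = π (m q) → q = p := by
    intro q h1 h2
    rcases (h.proj_eq _ _).1 h1 with rfl | rfl
    · rfl
    · rcases (h.proj_eq _ _).1 h2 with h3 | h3
      · exact h.match_invol.injective h3
      · exact absurd h3 (h.match_twin_ne hV p)
  rcases Sym2.eq_iff.1 hpq with ⟨h1, h2⟩ | ⟨h1, h2⟩
  · exact Or.inl (key q h1 h2)
  · right
    rw [← key (m q) h1 (by rw [h.match_invol, h2]), h.match_invol]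

open SimpleGraph in
theorem isHamCycleEdgeSet [Fintype V] [DecidableEq V] (h : PortSystem π m nu)
    (hV : 3 ≤ Fintype.card V) :
    IsHamCycleEdgeSet (Set.range fun p => s(π p, π (m p))) := by
  have hadj : ∀ p, (fromEdgeSet (Set.range fun p => s(π p, π (m p)))).Adj (π p) (π (m p)) :=
    fun p => (fromEdgeSet_adj _).2 ⟨⟨p, rfl⟩, h.proj_match_ne hV p⟩
  refine isHamCycleEdgeSet_of_connected ?_ ?_ ?_
  · rintro _ ⟨p, rfl⟩
    exact h.proj_match_ne hV p
  · have : Nonempty V := Fintype.card_pos_iff.1 (by omega)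
    refine ⟨fun u v => ?_⟩
    obtain ⟨p, rfl⟩ := h.surj u
    obtain ⟨q, rfl⟩ := h.surj v
    refine h.conn (fun x => (fromEdgeSet _).Reachable (π p) (π x)) (fun x => ?_)
      (fun x => by rw [h.proj_twin]) p q (Reachable.refl _)
    exact ⟨fun hx => hx.trans (hadj x).reachable.symm, fun hx => hx.trans (hadj x).reachable⟩
  · intro v
    obtain ⟨p, rfl⟩ := h.surj v
    have hset : (fromEdgeSet (Set.range fun p => s(π p, π (m p)))).neighborSet (π p)
        = {π (m p), π (m (nu p))} := by
      ext w
      constructor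
      · intro hw
        obtain ⟨⟨q, hq⟩, -⟩ := (fromEdgeSet_adj _).1 hw
        have key : ∀ q, π p = π q → π (m q) = w → w ∈ ({π (m p), π (m (nu p))} : Set V) := by
          rintro q h1 rfl
          rcases (h.proj_eq _ _).1 h1 with rfl | rfl <;> simp
        rcases Sym2.eq_iff.1 hq with ⟨h1, h2⟩ | ⟨h1, h2⟩
        · exact key q h1.symm h2
        · exact key (m q) h2.symm (by rw [h.match_invol, h1])
      · rintro (rfl | rfl)
        · exact hadj p
        · have := hadj (nu p)
          rwa [h.proj_twin] at this
    rw [hset, Set.ncard_pair]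
    intro heq
    rcases (h.proj_eq _ _).1 heq with h1 | h1
    · exact h.twin_ne p (h.match_invol.injective h1)
    · exact h.match_twin_ne hV p h1

end PortSystem

/-- A perfect matching is the graph of a fixed-point-free involution. -/
theorem IsPerfectMatchingEdgeSet.exists_involutive {V : Type*} {M : Set (Sym2 V)}
    (hM : IsPerfectMatchingEdgeSet M) :
    ∃ m : V → V, Function.Involutive m ∧ (∀ v, m v ≠ v) ∧ ∀ v w, s(v, w) ∈ M ↔ w = m v := by
  have hex : ∀ v, ∃ w, s(v, w) ∈ M := by
    intro v
    obtain ⟨e, ⟨he, w, rfl⟩, -⟩ := hM.2 v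
    exact ⟨w, he⟩
  choose m hm using hex
  have hiff : ∀ v w, s(v, w) ∈ M ↔ w = m v := by
    refine fun v w => ⟨fun h => ?_, fun h => h ▸ hm v⟩
    exact Sym2.congr_right.1 ((hM.2 v).unique ⟨h, Sym2.mem_mk_left _ _⟩
      ⟨hm v, Sym2.mem_mk_left _ _⟩)
  refine ⟨m, fun v => ?_, fun v hv => ?_, hiff⟩
  · exact ((hiff (m v) v).1 (Sym2.eq_swap ▸ hm v)).symm
  · exact hM.1 _ (hm v) hv.symm

open SimpleGraph in
theorem IsPerfectMatchingEdgeSet.two_mul_ncard {V : Type*} [Fintype V] {M : Set (Sym2 V)}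
    (hM : IsPerfectMatchingEdgeSet M) : 2 * M.ncard = Fintype.card V := by
  classical
  obtain ⟨m, -, hne, hiff⟩ := hM.exists_involutive
  have hdeg : ∀ v, (fromEdgeSet M).degree v = 1 := by
    intro v
    rw [degree_eq_one_iff_existsUnique_adj]
    refine ⟨m v, (fromEdgeSet_adj M).2 ⟨(hiff _ _).2 rfl, (hne v).symm⟩, fun w hw => ?_⟩
    exact (hiff _ _).1 ((fromEdgeSet_adj M).1 hw).1
  have hedge : (fromEdgeSet M).edgeSet = M := by
    rw [edgeSet_fromEdgeSet]
    exact sdiff_eq_left.2 (Set.disjoint_left.2 fun e he => hM.1 e he)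
  have hsum := (fromEdgeSet M).sum_degrees_eq_twice_card_edges
  simp only [hdeg, Finset.sum_const, Finset.card_univ, smul_eq_mul, mul_one] at hsum
  rw [hsum, ← Set.ncard_coe_finset, coe_edgeFinset, hedge]

/-- The cyclic successor on `Fin n`. -/
def cyclicSucc (n : ℕ) (i : Fin n) : Fin n :=
  ⟨(i.val + 1) % n, Nat.mod_lt _ (by have := i.isLt; omega)⟩

theorem cyclicSucc_val (n : ℕ) (i : Fin n) :
    (i.val + 1 < n ∧ (cyclicSucc n i).val = i.val + 1) ∨
      (i.val + 1 = n ∧ (cyclicSucc n i).val = 0) := by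
  rcases Nat.lt_or_ge (i.val + 1) n with h | h
  · exact Or.inl ⟨h, Nat.mod_eq_of_lt h⟩
  · have h' : i.val + 1 = n := by omega
    exact Or.inr ⟨h', by simp [cyclicSucc, h']⟩

theorem cyclicSucc_bijective (n : ℕ) : Function.Bijective (cyclicSucc n) := by
  rw [← Finite.injective_iff_bijective]
  intro i j hij
  have := congrArg Fin.val hij
  have := cyclicSucc_val n i
  have := cyclicSucc_val n j
  ext
  omega

theorem tourEdge_injective {n : ℕ} (hn : 3 ≤ n) : Function.Injective (tourEdge n) := by
  intro i j hij
  rcases Sym2.eq_iff.1 (show s(i, cyclicSucc n i) = s(j, cyclicSucc n j) from hij) with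
    ⟨h, -⟩ | ⟨h1, h2⟩
  · exact h
  · have := congrArg Fin.val h1
    have := congrArg Fin.val h2
    have := cyclicSucc_val n i
    have := cyclicSucc_val n j
    omega

/-- The vertex at which a port of the tour sits: `(i, false)` and `(i, true)` are the left and the
right end of the `i`-th tour edge. -/
def portVertex (n : ℕ) (p : Fin n × Bool) : Fin n :=
  if p.2 then cyclicSucc n p.1 else p.1

/-- The other port sitting at the same vertex. -/
noncomputable def portTwin (n : ℕ) (p : Fin n × Bool) : Fin n × Bool :=
  if p.2 then (cyclicSucc n p.1, false)
  else ((Equiv.ofBijective _ (cyclicSucc_bijective n)).symm p.1, true)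

theorem portVertex_eq_iff (n : ℕ) (p q : Fin n × Bool) :
    portVertex n p = portVertex n q ↔ q = p ∨ q = portTwin n p := by
  obtain ⟨i, b⟩ := p
  obtain ⟨j, c⟩ := q
  have hinj := (cyclicSucc_bijective n).injective
  cases b <;> cases c <;>
    simp [portVertex, portTwin, Equiv.eq_symm_apply, hinj.eq_iff, eq_comm]

/-- The port of the tour corresponding to a vertex of a connection pattern. -/
def patternPort {n k : ℕ} (f : Fin k → Fin n) (x : Fin (2 * k)) : Fin n × Bool :=
  (f ⟨x.val / 2, by have := x.isLt; omega⟩, decide (x.val % 2 = 1))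

theorem portVertex_patternPort {n k : ℕ} (f : Fin k → Fin n) (x : Fin (2 * k)) :
    portVertex n (patternPort f x) = endpointMap n k f x := by
  rcases Nat.mod_two_eq_zero_or_one x.val with h | h <;>
    simp [portVertex, patternPort, endpointMap, cyclicSucc, h]

theorem patternPort_injective {n k : ℕ} {f : Fin k → Fin n} (hf : Function.Injective f) :
    Function.Injective (patternPort f) := by
  intro x y hxy
  have h1 := congrArg Fin.val (hf (congrArg Prod.fst hxy))
  have h2 := congrArg Prod.snd hxy
  simp only [patternPort, decide_eq_decide] at h1 h2
  ext
  omega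

theorem patternPort_surj {n k : ℕ} (f : Fin k → Fin n) (j : Fin k) (b : Bool) :
    ∃ x, patternPort f x = (f j, b) := by
  refine ⟨⟨2 * j.val + b.toNat, ?_⟩, ?_⟩
  · have := j.isLt
    have := b.toNat_le
    omega
  · cases b <;> simp [patternPort, Nat.mul_add_div]

theorem exists_patternPort_iff {n k : ℕ} (f : Fin k → Fin n) (p : Fin n × Bool) :
    (∃ x, patternPort f x = p) ↔ ∃ j, f j = p.1 := by
  constructor
  · rintro ⟨x, rfl⟩
    exact ⟨_, rfl⟩
  · rintro ⟨j, hj⟩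
    obtain ⟨x, hx⟩ := patternPort_surj f j p.2
    exact ⟨x, by rw [hx, hj]⟩

/-- The matching on the ports of the tour after the exchange: ports of removed edges are matched
by the pattern, the other ports are matched along their tour edge. -/
noncomputable def portMatch {n k : ℕ} (f : Fin k → Fin n) (m : Fin (2 * k) → Fin (2 * k)) :
    Fin n × Bool → Fin n × Bool :=
  Function.extend (patternPort f) (patternPort f ∘ m) fun p => (p.1, !p.2)

section portMatch

variable {n k : ℕ} {f : Fin k → Fin n} {m : Fin (2 * k) → Fin (2 * k)}

theorem portMatch_patternPort (hf : Function.Injective f) (x : Fin (2 * k)) :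
    portMatch f m (patternPort f x) = patternPort f (m x) :=
  (patternPort_injective hf).extend_apply _ _ _

theorem portMatch_of_notMem {i : Fin n} (hi : ∀ j, f j ≠ i) (b : Bool) :
    portMatch f m (i, b) = (i, !b) :=
  Function.extend_apply' _ _ _ fun h => by
    obtain ⟨j, hj⟩ := (exists_patternPort_iff f (i, b)).1 h
    exact hi j hj

theorem mem_range_patternPort_or (f : Fin k → Fin n) (p : Fin n × Bool) :
    (∃ x, patternPort f x = p) ∨ ∀ j, f j ≠ p.1 := by
  rw [exists_patternPort_iff]
  exact or_iff_not_imp_left.2 fun h j hj => h ⟨j, hj⟩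

theorem portMatch_involutive (hf : Function.Injective f) (hm : Function.Involutive m) :
    Function.Involutive (portMatch f m) := by
  intro p
  rcases mem_range_patternPort_or f p with ⟨x, rfl⟩ | h
  · rw [portMatch_patternPort hf, portMatch_patternPort hf, hm]
  · rw [← Prod.mk.eta (p := p), portMatch_of_notMem h, portMatch_of_notMem h, Bool.not_not]

theorem portMatch_ne (hf : Function.Injective f) (hm : ∀ x, m x ≠ x) (p : Fin n × Bool) :
    portMatch f m p ≠ p := by
  rcases mem_range_patternPort_or f p with ⟨x, rfl⟩ | h
  · rw [portMatch_patternPort hf]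
    exact fun h => hm x (patternPort_injective hf h)
  · obtain ⟨i, b⟩ := p
    simp [portMatch_of_notMem h]

/-- Along a stretch of kept tour edges, a stable property of ports is constant. -/
theorem stretch_iff (hn : 0 < n) {S : Fin n × Bool → Prop}
    (hSm : ∀ p, S (portMatch f m p) ↔ S p) (hSt : ∀ p, S (portTwin n p) ↔ S p)
    {a b : ℕ} (hab : a + 1 ≤ b)
    (hkept : ∀ s, a < s → s < b → ∀ j, f j ≠ ⟨s % n, Nat.mod_lt _ hn⟩) :
    S (⟨a % n, Nat.mod_lt _ hn⟩, true) ↔ S (⟨b % n, Nat.mod_lt _ hn⟩, false) := by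
  have hstep : ∀ t : ℕ, S (⟨t % n, Nat.mod_lt _ hn⟩, true) ↔
      S (⟨(t + 1) % n, Nat.mod_lt _ hn⟩, false) := by
    intro t
    rw [← hSt (⟨t % n, Nat.mod_lt _ hn⟩, true)]
    simp [portTwin, cyclicSucc]
  induction b, hab using Nat.le_induction with
  | base => exact hstep a
  | succ b hb ih =>
    refine (ih fun s h1 h2 => hkept s h1 (h2.trans b.lt_succ_self)).trans ?_
    rw [← hstep b, ← hSm (_, false),
      portMatch_of_notMem (hkept b (by omega) (by omega)), Bool.not_false]

/-- A property of ports stable under the exchanged matching and under twins is constant as soon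
as the pattern is connected. -/
theorem port_conn (hk : 0 < k) (hf : StrictMono f) {M : Set (Sym2 (Fin (2 * k)))}
    (hconn : (SimpleGraph.fromEdgeSet (M ∪ nuEdges k)).Connected)
    (hM : ∀ v w, s(v, w) ∈ M ↔ w = m v) {S : Fin n × Bool → Prop}
    (hSm : ∀ p, S (portMatch f m p) ↔ S p) (hSt : ∀ p, S (portTwin n p) ↔ S p)
    (p q : Fin n × Bool) (hp : S p) : S q := by
  have hn : 0 < n := by have := (f ⟨0, hk⟩).isLt; omega
  have hnu : ∀ j : Fin k,
      S (patternPort f ⟨(2 * j.val + 1) % (2 * k), Nat.mod_lt _ (by omega)⟩) ↔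
        S (patternPort f ⟨(2 * j.val + 2) % (2 * k), Nat.mod_lt _ (by omega)⟩) := by
    intro j
    have hfirst : patternPort f ⟨(2 * j.val + 1) % (2 * k), Nat.mod_lt _ (by omega)⟩
        = (⟨(f j).val % n, Nat.mod_lt _ hn⟩, true) := by
      have : (2 * j.val + 1) % (2 * k) = 2 * j.val + 1 := Nat.mod_eq_of_lt (by omega)
      simp [patternPort, this, Nat.mod_eq_of_lt (f j).isLt, Nat.mul_add_div]
    rw [hfirst]
    rcases Nat.lt_or_ge (j.val + 1) k with hj | hj
    · have hsecond : patternPort f ⟨(2 * j.val + 2) % (2 * k), Nat.mod_lt _ (by omega)⟩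
          = (⟨(f ⟨j.val + 1, hj⟩).val % n, Nat.mod_lt _ hn⟩, false) := by
        have : (2 * j.val + 2) % (2 * k) = 2 * j.val + 2 := Nat.mod_eq_of_lt (by omega)
        simp [patternPort, this, Nat.mod_eq_of_lt (f _).isLt]
      rw [hsecond]
      refine stretch_iff hn hSm hSt (hf (Fin.mk_lt_mk.2 (Nat.lt_succ_self j.val))) ?_
      intro s h1 h2 i hi
      have hs : s < n := h2.trans (f _).isLt
      have hiv : (f i).val = s := (congrArg Fin.val hi).trans (Nat.mod_eq_of_lt hs)
      have h3 : j < i := hf.lt_iff_lt.1 (Fin.lt_def.2 (by omega))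
      have h4 : i < ⟨j.val + 1, hj⟩ := hf.lt_iff_lt.1 (Fin.lt_def.2 (by omega))
      rw [Fin.lt_def] at h3 h4
      dsimp only at h4
      omega
    · have hj' : j.val + 1 = k := by omega
      have hsecond : patternPort f ⟨(2 * j.val + 2) % (2 * k), Nat.mod_lt _ (by omega)⟩
          = (⟨((f ⟨0, hk⟩).val + n) % n, Nat.mod_lt _ hn⟩, false) := by
        have : (2 * j.val + 2) % (2 * k) = 0 := by
          rw [show 2 * j.val + 2 = 2 * k by omega, Nat.mod_self]
        simp [patternPort, this, Nat.mod_eq_of_lt (f _).isLt]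
      rw [hsecond]
      refine stretch_iff hn hSm hSt (by have := (f j).isLt; omega) ?_
      intro s h1 h2 i hi
      have hiv : (f i).val = s % n := congrArg Fin.val hi
      rcases Nat.lt_or_ge s n with hs | hs
      · rw [Nat.mod_eq_of_lt hs] at hiv
        have : f i ≤ f j := hf.monotone (Fin.le_def.2 (by omega))
        rw [Fin.le_def] at this
        omega
      · have hs' : s - n < n := by have := (f ⟨0, hk⟩).isLt; omega
        rw [Nat.mod_eq_sub_mod hs, Nat.mod_eq_of_lt hs'] at hiv
        have : f ⟨0, hk⟩ ≤ f i := hf.monotone (Fin.le_def.2 (Nat.zero_le _))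
        rw [Fin.le_def] at this
        omega
  have hadj : ∀ x y, (SimpleGraph.fromEdgeSet (M ∪ nuEdges k)).Adj x y →
      (S (patternPort f x) ↔ S (patternPort f y)) := by
    intro x y hxy
    rcases ((SimpleGraph.fromEdgeSet_adj _).1 hxy).1 with h | ⟨j, hj⟩
    · rw [(hM x y).1 h, ← portMatch_patternPort hf.injective, hSm]
    · rcases Sym2.eq_iff.1 hj with ⟨rfl, rfl⟩ | ⟨rfl, rfl⟩
      · exact hnu j
      · exact (hnu j).symm
  have hpattern : ∀ x y, S (patternPort f x) ↔ S (patternPort f y) := by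
    intro x y
    obtain ⟨w⟩ := hconn.preconnected x y
    induction w with
    | nil => rfl
    | cons h _ ih => exact (hadj _ _ h).trans ih
  have hremoved : ∀ i j b c, S (f i, b) ↔ S (f j, c) := by
    intro i j b c
    obtain ⟨x, hx⟩ := patternPort_surj f i b
    obtain ⟨y, hy⟩ := patternPort_surj f j c
    rw [← hx, ← hy]
    exact hpattern x y
  have hall : ∀ t, (f ⟨0, hk⟩).val ≤ t → ∀ b,
      (S (⟨t % n, Nat.mod_lt _ hn⟩, b) ↔ S (f ⟨0, hk⟩, true)) := by
    intro t ht
    induction t, ht using Nat.le_induction with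
    | base =>
      intro b
      simp only [Nat.mod_eq_of_lt (f ⟨0, hk⟩).isLt, Fin.eta]
      exact hremoved _ _ _ _
    | succ t ht ih =>
      intro b
      by_cases hmem : ∃ j, f j = ⟨(t + 1) % n, Nat.mod_lt _ hn⟩
      · obtain ⟨j, hj⟩ := hmem
        rw [← hj]
        exact hremoved _ _ _ _
      · have hfalse : S (⟨(t + 1) % n, Nat.mod_lt _ hn⟩, false) ↔ S (f ⟨0, hk⟩, true) :=
          (stretch_iff hn hSm hSt le_rfl fun s h1 h2 => by omega).symm.trans (ih true)
        cases b with
        | false => exact hfalse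
        | true =>
          rw [← hSm, portMatch_of_notMem fun j hj => hmem ⟨j, hj⟩, Bool.not_true]
          exact hfalse
  have hconst : ∀ p, S p ↔ S (f ⟨0, hk⟩, true) := by
    rintro ⟨i, b⟩
    have := hall (i.val + n) (by have := (f ⟨0, hk⟩).isLt; omega) b
    simpa only [Nat.add_mod_right, Nat.mod_eq_of_lt i.isLt, Fin.eta] using this
  exact (hconst q).2 ((hconst p).1 hp)

theorem portSystem (hk : 0 < k) (hf : StrictMono f) {M : Set (Sym2 (Fin (2 * k)))}
    (hconn : (SimpleGraph.fromEdgeSet (M ∪ nuEdges k)).Connected)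
    (hM : ∀ v w, s(v, w) ∈ M ↔ w = m v) (hinv : Function.Involutive m) (hne : ∀ x, m x ≠ x) :
    PortSystem (portVertex n) (portMatch f m) (portTwin n) where
  surj v := ⟨(v, false), rfl⟩
  match_invol := portMatch_involutive hf.injective hinv
  match_ne := portMatch_ne hf.injective hne
  twin_ne := by
    rintro ⟨i, b⟩ h
    cases b <;> simpa [portTwin] using congrArg Prod.snd h
  proj_eq := portVertex_eq_iff n
  conn _ hSm hSt p q hp := port_conn hk hf hconn hM hSm hSt p q hp

theorem exchange_eq_range (hn : 3 ≤ n) (hf : Function.Injective f)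
    {M : Set (Sym2 (Fin (2 * k)))} (hM : ∀ v w, s(v, w) ∈ M ↔ w = m v) :
    (tourEdgeSet n \ EminusSet n k f) ∪ EplusSet n k f M =
      Set.range fun p => s(portVertex n p, portVertex n (portMatch f m p)) := by
  have hpat : ∀ x, s(portVertex n (patternPort f x),
      portVertex n (portMatch f m (patternPort f x))) =
        Sym2.map (endpointMap n k f) s(x, m x) := fun x => by
    rw [portMatch_patternPort hf, portVertex_patternPort, portVertex_patternPort, Sym2.map_mk]
  have hkept : ∀ i b, (∀ j, f j ≠ i) →
      s(portVertex n (i, b), portVertex n (portMatch f m (i, b))) = tourEdge n i := by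
    intro i b hi
    rw [portMatch_of_notMem hi]
    cases b
    · rfl
    · exact Sym2.eq_swap
  ext e
  constructor
  · rintro (⟨⟨i, rfl⟩, he⟩ | ⟨e, he, rfl⟩)
    · exact ⟨(i, false), hkept i false fun j hj => he ⟨j, by rw [hj]⟩⟩
    · induction e using Sym2.ind with
      | _ x y =>
        obtain rfl := (hM x y).1 he
        exact ⟨patternPort f x, hpat x⟩
  · rintro ⟨p, rfl⟩
    rcases mem_range_patternPort_or f p with ⟨x, rfl⟩ | h
    · exact Or.inr ⟨s(x, m x), (hM _ _).2 rfl, (hpat x).symm⟩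
    · refine Or.inl ?_
      dsimp only
      rw [← Prod.mk.eta (p := p), hkept _ _ h]
      refine ⟨⟨_, rfl⟩, ?_⟩
      rintro ⟨j, hj⟩
      exact h j (tourEdge_injective hn hj).symm

end portMatch

/-- If `f : [k] → [n]` is strictly increasing and `M` is a valid
connection `k`-pattern, then `(E(H) \ E⁻_f) ∪ E⁺_{(f,M)}` is the edge set of a
Hamiltonian cycle of `G`; in particular `(E⁻_f, E⁺_{(f,M)})` is a `k`-move. -/
theorem stmt_0 (n k : ℕ) (hn : 3 ≤ n) (hk : 2 ≤ k) (hkn : k ≤ n)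
    (f : Fin k → Fin n) (hf : StrictMono f)
    (M : Set (Sym2 (Fin (2 * k)))) (hM : IsValidPattern k M) :
    IsHamCycleEdgeSet ((tourEdgeSet n \ EminusSet n k f) ∪ EplusSet n k f M) ∧
      IsKMove n k (EminusSet n k f) (EplusSet n k f M) := by
  obtain ⟨m, hinv, hne, hiff⟩ := hM.1.exists_involutive
  have hsys : PortSystem (portVertex n) (portMatch f m) (portTwin n) :=
    portSystem (by omega) hf hM.2 hiff hinv hne
  have hV : 3 ≤ Fintype.card (Fin n) := by rwa [Fintype.card_fin]
  have hham : IsHamCycleEdgeSet ((tourEdgeSet n \ EminusSet n k f) ∪ EplusSet n k f M) := by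
    rw [exchange_eq_range hn hf.injective hiff]
    exact hsys.isHamCycleEdgeSet hV
  have hpat : ∀ x, endpointMap n k f (m x) = portVertex n (portMatch f m (patternPort f x)) :=
    fun x => by rw [portMatch_patternPort hf.injective, portVertex_patternPort]
  refine ⟨hham, ?_, ?_, ?_, ?_, hham⟩
  · have : EminusSet n k f = Set.range (tourEdge n ∘ f) := by
      ext e
      exact exists_congr fun j => eq_comm
    rw [this, ← Set.image_univ, Set.ncard_image_of_injective _
      ((tourEdge_injective hn).comp hf.injective), Set.ncard_univ, Nat.card_fin]
  · have hinj : Set.InjOn (Sym2.map (endpointMap n k f)) M := by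
      intro e he e' he' hee
      induction e using Sym2.ind with
      | _ x y =>
      induction e' using Sym2.ind with
      | _ x' y' =>
        obtain rfl := (hiff x y).1 he
        obtain rfl := (hiff x' y').1 he'
        rw [Sym2.map_mk, Sym2.map_mk, hpat, hpat, ← portVertex_patternPort,
          ← portVertex_patternPort] at hee
        rcases hsys.edge_inj hV hee with h | h
        · rw [patternPort_injective hf.injective h]
        · rw [portMatch_patternPort hf.injective] at h
          rw [patternPort_injective hf.injective h, hinv, Sym2.eq_swap]
    have := hM.1.two_mul_ncard
    rw [Fintype.card_fin] at this
    rw [EplusSet, hinj.ncard_image]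
    omega
  · rintro _ ⟨j, rfl⟩
    exact ⟨f j, rfl⟩
  · rintro _ ⟨e, he, rfl⟩
    induction e using Sym2.ind with
    | _ x y =>
      obtain rfl := (hiff x y).1 he
      rw [Sym2.map_mk, hpat, ← portVertex_patternPort]
      exact hsys.proj_match_ne hV _
end

section
/- Let n ≥ 3 and 2 ≤ k ≤ n, and let Q = (E⁻, E⁺) be a k-move with E⁻ = {e_{i_1},…,e_{i_k}}, i_1 < … < i_k. For j = 1,…,k let v_{2j−1} and v_{2j} be the left and right endpoint of e_{i_j}. Then there exists at least one perfect matching M on [2k] with E⁺ = {{v_i, v_j} : {i,j} ∈ M}, and every perfect matching M on [2k] satisfying E⁺ = {{v_i, v_j} : {i,j} ∈ M} is a valid connection k-pattern. -/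
/-- If every vertex `x` has as many preimages under `v` as there are edges at `x` in a loopless
edge set `E`, then `E` is the image under `v` of the edge set of a perfect matching. -/
theorem exists_perfectMatching_image_eq {P V : Type*} [Finite P] [Finite V] (v : P → V)
    (E : Set (Sym2 V)) (hE : ∀ e ∈ E, ¬ e.IsDiag)
    (hcard : ∀ x, {p | v p = x}.ncard = {e | e ∈ E ∧ x ∈ e}.ncard) :
    ∃ M : Set (Sym2 P), IsPerfectMatchingEdgeSet M ∧ E = Sym2.map v '' M := by
  have hbij : ∀ x, ∃ φ : P → Sym2 V,
      Set.BijOn φ {p | v p = x} {e | e ∈ E ∧ x ∈ e} := fun x => by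
    classical
    obtain ⟨ψ⟩ : Nonempty ({p | v p = x} ≃ {e | e ∈ E ∧ x ∈ e}) :=
      (Finite.card_eq (α := {p | v p = x}) (β := {e | e ∈ E ∧ x ∈ e})).1 (hcard x)
    refine ⟨fun p => if h : v p = x then (ψ ⟨p, h⟩ : Sym2 V) else s(x, x), ?_, ?_, ?_⟩
    · intro p hp
      have hp' : v p = x := hp
      simp only [hp', dite_true]
      exact (ψ ⟨p, hp⟩).2
    · intro p hp q hq hpq
      have hp' : v p = x := hp
      have hq' : v q = x := hq
      simp only [hp', hq', dite_true] at hpq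
      simpa using ψ.injective (Subtype.ext hpq)
    · intro e he
      obtain ⟨⟨p, hp⟩, hpe⟩ := ψ.surjective ⟨e, he⟩
      have hp' : v p = x := hp
      exact ⟨p, hp, by simp only [hp', dite_true]; exact congrArg Subtype.val hpe⟩
  choose φ hφ using hbij
  set g : P → Sym2 V := fun p => φ (v p) p with hg
  have hgE : ∀ p, g p ∈ E := fun p => ((hφ (v p)).mapsTo rfl).1
  have hgv : ∀ p, v p ∈ g p := fun p => ((hφ (v p)).mapsTo rfl).2
  have hinj : ∀ p q, v p = v q → g p = g q → p = q := fun p q hpq h =>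
    (hφ (v q)).injOn hpq rfl (by simpa only [hg, hpq] using h)
  have hsurj : ∀ e ∈ E, ∀ x ∈ e, ∃ p, v p = x ∧ g p = e := fun e he x hx => by
    obtain ⟨p, hp, hpe⟩ := (hφ x).surjOn ⟨he, hx⟩
    have hp' : v p = x := hp
    exact ⟨p, hp, by simpa only [hg, hp'] using hpe⟩
  have hmap : ∀ p q, p ≠ q → g p = g q → s(v p, v q) = g p := fun p q hpq h =>
    (((Sym2.mem_and_mem_iff fun hv => hpq (hinj p q hv h)).1 ⟨hgv p, h ▸ hgv q⟩)).symm
  refine ⟨{e | ∃ p q, p ≠ q ∧ g p = g q ∧ e = s(p, q)}, ⟨?_, ?_⟩, ?_⟩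
  · rintro _ ⟨p, q, hpq, -, rfl⟩
    simpa using hpq
  · intro p
    obtain ⟨y, hy⟩ := hgv p
    have hne : v p ≠ y := fun h => hE _ (hgE p) (by rw [hy]; simpa using h)
    obtain ⟨q, hq, hqp⟩ := hsurj (g p) (hgE p) y (by rw [hy]; simp)
    have hpq : p ≠ q := fun h => hne (by rw [h, hq])
    have huniq : ∀ r, p ≠ r → g p = g r → r = q := fun r hr h => by
      have h1 := (hmap p r hr h).trans hy
      rw [Sym2.congr_right] at h1
      exact hinj r q (h1.trans hq.symm) (h.symm.trans hqp.symm)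
    refine ⟨s(p, q), ⟨⟨p, q, hpq, hqp.symm, rfl⟩, by simp⟩, ?_⟩
    rintro _ ⟨⟨a, b, hab, hgab, rfl⟩, hp⟩
    rcases Sym2.mem_iff.1 hp with rfl | rfl
    · rw [huniq b hab hgab]
    · rw [huniq a hab.symm hgab.symm, Sym2.eq_swap]
  · ext e
    constructor
    · intro he
      induction e with | _ x y =>
      have hne : x ≠ y := fun h => hE _ he (by simpa using h)
      obtain ⟨p, rfl, hpe⟩ := hsurj _ he x (by simp)
      obtain ⟨q, rfl, hqe⟩ := hsurj _ he y (by simp)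
      exact ⟨s(p, q), ⟨p, q, fun h => hne (by rw [h]), hpe.trans hqe.symm, rfl⟩, by simp⟩
    · rintro ⟨_, ⟨p, q, hpq, h, rfl⟩, rfl⟩
      rw [Sym2.map_mk, hmap p q hpq h]
      exact hgE p

/-- Connectedness transfers along a map of vertices `c` that sends edges to reachable pairs
and meets every component of the target. -/
theorem connected_of_adj_reachable {V P : Type*} {G : SimpleGraph V} {G' : SimpleGraph P}
    [Nonempty P] (hG : G.Preconnected) (c : V → P) (v : P → V)
    (hc : ∀ x y, G.Adj x y → G'.Reachable (c x) (c y))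
    (hv : ∀ p, G'.Reachable p (c (v p))) : G'.Connected := by
  have hwalk : ∀ x y, G.Walk x y → G'.Reachable (c x) (c y) := fun x y w => by
    induction w with
    | nil => rfl
    | cons h _ ih => exact (hc _ _ h).trans ih
  refine ⟨fun p q => ?_⟩
  obtain ⟨w⟩ := hG (v p) (v q)
  exact ((hv p).trans (hwalk _ _ w)).trans (hv q).symm

theorem IsHamCycleEdgeSet.ncard_eq {V : Type*} [Fintype V] [DecidableEq V] {E : Set (Sym2 V)}
    (h : IsHamCycleEdgeSet E) : E.ncard = Fintype.card V := by
  obtain ⟨u, p, hp, hE⟩ := h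
  have : E = (p.edges.toFinset : Set (Sym2 V)) := by ext e; simp [hE]
  rw [this, Set.ncard_coe_finset, List.toFinset_card_of_nodup hp.isCycle.edges_nodup,
    SimpleGraph.Walk.length_edges, hp.length_eq]

theorem IsHamCycleEdgeSet.ncard_mem_eq_two {V : Type*} [Fintype V] [DecidableEq V]
    {E : Set (Sym2 V)} (h : IsHamCycleEdgeSet E) (x : V) : {e | e ∈ E ∧ x ∈ e}.ncard = 2 := by
  obtain ⟨u, p, hp, hE⟩ := h
  rw [← hp.isCycle.ncard_neighborSet_toSubgraph_eq_two (hp.mem_support x)]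
  have himg : {e | e ∈ E ∧ x ∈ e} = (fun y => s(x, y)) '' p.toSubgraph.neighborSet x := by
    ext e
    simp only [Set.mem_ofPred_eq, Set.mem_image, SimpleGraph.Subgraph.mem_neighborSet,
      ← SimpleGraph.Subgraph.mem_edgeSet, SimpleGraph.Walk.mem_edges_toSubgraph, ← hE]
    constructor
    · rintro ⟨he, y, rfl⟩
      exact ⟨y, he, rfl⟩
    · rintro ⟨y, hy, rfl⟩
      exact ⟨hy, by simp⟩
  rw [himg, Set.ncard_image_of_injective _ fun a b hab => Sym2.congr_right.1 hab]

theorem IsHamCycleEdgeSet.preconnected {V : Type*} [Fintype V] [DecidableEq V]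
    {E : Set (Sym2 V)} (h : IsHamCycleEdgeSet E) : (SimpleGraph.fromEdgeSet E).Preconnected := by
  obtain ⟨u, p, hp, -⟩ := h
  have hu : ∀ x, (SimpleGraph.fromEdgeSet E).Reachable u x := fun x =>
    ⟨p.takeUntil x (hp.mem_support x)⟩
  exact fun x y => (hu x).symm.trans (hu y)

theorem val_add_one_mod {n : ℕ} (i : Fin n) :
    (i.val + 1 < n ∧ (i.val + 1) % n = i.val + 1) ∨ (i.val + 1 = n ∧ (i.val + 1) % n = 0) := by
  rcases (Nat.succ_le_of_lt i.isLt).lt_or_eq with h | h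
  · exact Or.inl ⟨h, Nat.mod_eq_of_lt h⟩
  · have h' : i.val + 1 = n := h
    exact Or.inr ⟨h', by rw [h', Nat.mod_self]⟩

theorem tourEdge_not_isDiag {n : ℕ} (hn : 3 ≤ n) (i : Fin n) : ¬ (tourEdge n i).IsDiag := by
  have hi := val_add_one_mod i
  simp only [tourEdge, Sym2.mk_isDiag_iff, Fin.ext_iff]
  omega

theorem ncard_tourEdgeSet {n : ℕ} (hn : 3 ≤ n) : (tourEdgeSet n).ncard = n := by
  rw [tourEdgeSet, ← Set.image_univ, Set.ncard_image_of_injective _ (tourEdge_injective hn),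
    Set.ncard_univ, Nat.card_fin]

theorem ncard_mem_tourEdgeSet {n : ℕ} (hn : 3 ≤ n) (x : Fin n) :
    {e | e ∈ tourEdgeSet n ∧ x ∈ e}.ncard = 2 := by
  obtain ⟨y, hy⟩ : ∃ y : Fin n, (y.val + 1) % n = x.val := by
    rcases Nat.eq_zero_or_pos x.val with h | h
    · exact ⟨⟨n - 1, by omega⟩, by simp [h, Nat.sub_add_cancel (by omega : 1 ≤ n)]⟩
    · refine ⟨⟨x.val - 1, by omega⟩, ?_⟩
      rw [Nat.sub_add_cancel h, Nat.mod_eq_of_lt x.isLt]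
  have hy' := val_add_one_mod y
  have hset : {e | e ∈ tourEdgeSet n ∧ x ∈ e} = {tourEdge n x, tourEdge n y} := by
    ext e
    simp only [Set.mem_ofPred_eq, Set.mem_insert_iff, Set.mem_singleton_iff]
    constructor
    · rintro ⟨⟨i, rfl⟩, hi⟩
      rw [tourEdge, Sym2.mem_iff] at hi
      rcases hi with rfl | hi
      · exact Or.inl rfl
      · have hi' := val_add_one_mod i
        simp only [Fin.ext_iff] at hi
        have : i = y := by ext; omega
        exact Or.inr (by rw [this])
    · rintro (rfl | rfl)
      · exact ⟨⟨x, rfl⟩, by simp [tourEdge]⟩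
      · exact ⟨⟨y, rfl⟩, by simp [tourEdge, Fin.ext_iff, hy]⟩
  rw [hset, Set.ncard_pair fun h => ?_]
  have := tourEdge_injective hn h
  rw [Fin.ext_iff] at this
  omega

/-- The vertices of `[2k]` lying over `x` correspond to the removed edges at `x`. -/
theorem ncard_endpointMap_fiber {n k : ℕ} (hn : 3 ≤ n) {f : Fin k → Fin n}
    (hf : Function.Injective f) (x : Fin n) :
    {p | endpointMap n k f p = x}.ncard = {e | e ∈ EminusSet n k f ∧ x ∈ e}.ncard := by
  have hmem : ∀ p : Fin (2 * k),
      endpointMap n k f p ∈ tourEdge n (f ⟨p.val / 2, by have := p.isLt; omega⟩) := fun p => by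
    unfold endpointMap tourEdge
    split_ifs <;> simp
  have himg : {e | e ∈ EminusSet n k f ∧ x ∈ e} =
      (fun p : Fin (2 * k) => tourEdge n (f ⟨p.val / 2, by have := p.isLt; omega⟩)) ''
        {p | endpointMap n k f p = x} := by
    ext e
    constructor
    · rintro ⟨⟨j, rfl⟩, hx⟩
      rw [tourEdge, Sym2.mem_iff] at hx
      rcases hx with rfl | rfl
      · exact ⟨⟨2 * j.val, by omega⟩, by simp [endpointMap], by simp⟩
      · refine ⟨⟨2 * j.val + 1, by omega⟩, ?_, ?_⟩
        · simp [endpointMap, Nat.add_mod, Nat.mul_add_div]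
        · simp [Nat.mul_add_div]
    · rintro ⟨p, rfl, rfl⟩
      exact ⟨⟨_, rfl⟩, hmem p⟩
  rw [himg, Set.InjOn.ncard_image]
  intro p hp q hq hpq
  have h1 := hf (tourEdge_injective hn hpq)
  have h2 : endpointMap n k f p = endpointMap n k f q := Eq.trans hp (Eq.symm hq)
  rw [Fin.ext_iff] at h1
  simp only at h1
  unfold endpointMap at h2
  simp only [h1] at h2
  have h3 := val_add_one_mod (f ⟨q.val / 2, by have := q.isLt; omega⟩)
  ext
  split_ifs at h2 <;> simp only [Fin.ext_iff] at h2 <;> omega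

theorem ncard_mem_eq_of_isKMove {n k : ℕ} (hn : 3 ≤ n) {Em Ep : Set (Sym2 (Fin n))}
    (h : IsKMove n k Em Ep) (x : Fin n) :
    {e | e ∈ Em ∧ x ∈ e}.ncard = {e | e ∈ Ep ∧ x ∈ e}.ncard := by
  obtain ⟨hEm, hEp, hsub, -, hham⟩ := h
  have hdiff := Set.ncard_sdiff_add_ncard_of_subset hsub
  have hdisj : Disjoint (tourEdgeSet n \ Em) Ep := by
    have h1 := Set.ncard_union_add_ncard_inter (tourEdgeSet n \ Em) Ep
    rw [hham.ncard_eq, Fintype.card_fin, hEp] at h1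
    rw [ncard_tourEdgeSet hn, hEm] at hdiff
    rw [Set.disjoint_iff_inter_eq_empty, ← Set.ncard_eq_zero]
    omega
  have h1 : {e | e ∈ tourEdgeSet n ∧ x ∈ e}.ncard =
      {e | e ∈ tourEdgeSet n \ Em ∧ x ∈ e}.ncard + {e | e ∈ Em ∧ x ∈ e}.ncard := by
    rw [← Set.ncard_union_eq]
    · congr 1
      ext e
      have := @hsub e
      simp only [Set.mem_ofPred_eq, Set.mem_union, Set.mem_sdiff]
      tauto
    · exact Set.disjoint_left.2 fun e he he' => he.1.2 he'.1
  have h2 : {e | e ∈ tourEdgeSet n \ Em ∪ Ep ∧ x ∈ e}.ncard =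
      {e | e ∈ tourEdgeSet n \ Em ∧ x ∈ e}.ncard + {e | e ∈ Ep ∧ x ∈ e}.ncard := by
    rw [← Set.ncard_union_eq]
    · congr 1
      ext e
      simp only [Set.mem_ofPred_eq, Set.mem_union]
      tauto
    · exact Set.disjoint_left.2 fun e he he' => Set.disjoint_left.1 hdisj he.1 he'.1
  rw [ncard_mem_tourEdgeSet hn] at h1
  rw [hham.ncard_mem_eq_two] at h2
  omega

/-- The number of removed tour edges that start before the vertex `w`. -/
def removedBefore {n k : ℕ} (f : Fin k → Fin n) (w : Fin n) : ℕ :=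
  (Finset.univ.filter fun j => f j < w).card

theorem removedBefore_zero {n k : ℕ} (f : Fin k → Fin n) {w : Fin n} (hw : w.val = 0) :
    removedBefore f w = 0 := by
  simp [removedBefore, Fin.lt_def, hw]

theorem removedBefore_apply {n k : ℕ} {f : Fin k → Fin n} (hf : StrictMono f) (j : Fin k) :
    removedBefore f (f j) = j := by
  rw [removedBefore, ← Fin.card_Iio j]
  congr 1
  ext i
  simp [hf.lt_iff_lt]

theorem removedBefore_of_val_eq {n k : ℕ} {f : Fin k → Fin n} (hf : StrictMono f) (j : Fin k)
    {w : Fin n} (hw : w.val = (f j).val + 1) : removedBefore f w = j + 1 := by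
  rw [removedBefore, ← Fin.card_Iic j]
  congr 1
  ext i
  simp only [Finset.mem_filter, Finset.mem_univ, true_and, Finset.mem_Iic, Fin.lt_def, hw,
    ← hf.le_iff_le (a := i), Fin.le_def]
  omega

theorem removedBefore_succ {n k : ℕ} {f : Fin k → Fin n} {i w : Fin n} (hi : ∀ j, f j ≠ i)
    (hw : w.val = i.val + 1) : removedBefore f w = removedBefore f i := by
  unfold removedBefore
  congr 1
  ext j
  have := hi j
  simp only [Finset.mem_filter, Finset.mem_univ, true_and, Fin.lt_def, hw, ne_eq,
    Fin.ext_iff] at this ⊢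
  omega

theorem removedBefore_last {n k : ℕ} {f : Fin k → Fin n} {i : Fin n} (hi : ∀ j, f j ≠ i)
    (hw : i.val + 1 = n) : removedBefore f i = k := by
  have hall : (Finset.univ.filter fun j => f j < i) = Finset.univ := by
    ext j
    have := hi j
    have := (f j).isLt
    simp only [Finset.mem_filter, Finset.mem_univ, true_and, Fin.lt_def, ne_eq, iff_true,
      Fin.ext_iff] at *
    omega
  rw [removedBefore, hall, Finset.card_univ, Fintype.card_fin]

/-- The vertex of `[2k]` (a left endpoint) at the end of the segment of the tour, cut at the
removed edges, that contains `w`. -/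
def segmentEnd {n k : ℕ} (hk : 0 < k) (f : Fin k → Fin n) (w : Fin n) : Fin (2 * k) :=
  ⟨2 * removedBefore f w % (2 * k), Nat.mod_lt _ (by omega)⟩

theorem segmentEnd_tourEdge {n k : ℕ} (hk : 0 < k) {f : Fin k → Fin n} {i w : Fin n}
    (hi : ∀ j, f j ≠ i) (hw : w.val = (i.val + 1) % n) :
    segmentEnd hk f w = segmentEnd hk f i := by
  rcases val_add_one_mod i with ⟨_, h⟩ | ⟨hn, h⟩
  · simp only [segmentEnd, removedBefore_succ hi (hw.trans h)]
  · simp only [segmentEnd, removedBefore_zero f (hw.trans h), removedBefore_last hi hn,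
      Nat.mul_zero, Nat.zero_mod, Nat.mod_self]

theorem segmentEnd_of_val_eq {n k : ℕ} (hk : 0 < k) {f : Fin k → Fin n} (hf : StrictMono f)
    (j : Fin k) {w : Fin n} (hw : w.val = ((f j).val + 1) % n) :
    (segmentEnd hk f w).val = (2 * j.val + 2) % (2 * k) := by
  rcases val_add_one_mod (f j) with ⟨_, h⟩ | ⟨hn, h⟩
  · simp only [segmentEnd, removedBefore_of_val_eq hf j (hw.trans h), Nat.mul_add, Nat.mul_one]
  · have hj : j.val + 1 = k := by
      by_contra hne
      have hlt : j < (⟨j.val + 1, by omega⟩ : Fin k) := Fin.lt_def.2 (Nat.lt_succ_self _)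
      have := Fin.lt_def.1 (hf hlt)
      omega
    have h2 : 2 * j.val + 2 = 2 * k := by omega
    simp only [segmentEnd, removedBefore_zero f (hw.trans h), h2, Nat.mul_zero, Nat.zero_mod,
      Nat.mod_self]

theorem reachable_segmentEnd {n k : ℕ} (hk : 0 < k) {f : Fin k → Fin n} (hf : StrictMono f)
    (M : Set (Sym2 (Fin (2 * k)))) (p : Fin (2 * k)) :
    (SimpleGraph.fromEdgeSet (M ∪ nuEdges k)).Reachable p
      (segmentEnd hk f (endpointMap n k f p)) := by
  rcases Nat.mod_two_eq_zero_or_one p.val with hp | hp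
  · have : segmentEnd hk f (endpointMap n k f p) = p := by
      ext
      simp only [segmentEnd, endpointMap, hp, if_true, removedBefore_apply hf]
      rw [Nat.mod_eq_of_lt (by omega)]
      omega
    rw [this]
  · have hval := segmentEnd_of_val_eq hk hf ⟨p.val / 2, by omega⟩
      (w := endpointMap n k f p) (by simp [endpointMap, hp])
    by_cases hne : p = segmentEnd hk f (endpointMap n k f p)
    · exact hne ▸ SimpleGraph.Reachable.refl _
    · refine SimpleGraph.Adj.reachable ((SimpleGraph.fromEdgeSet_adj _).2 ⟨Or.inr ?_, hne⟩)
      refine ⟨⟨p.val / 2, by omega⟩, ?_⟩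
      congr 2
      · ext
        simp only
        rw [Nat.mod_eq_of_lt (by omega)]
        omega
      · exact Fin.ext hval

/-- Let `Q = (E⁻, E⁺)` be a `k`-move, and let
`E⁻ = {e_{i_1}, …, e_{i_k}}` with `i_1 < … < i_k` (encoded by the strictly
increasing `f` with `E⁻ = E⁻_f`).  Then there exists at least one perfect
matching `M` on `[2k]` with `E⁺ = {{v_i, v_j} : {i,j} ∈ M}`, and every perfect
matching `M` with this property is a valid connection `k`-pattern. -/
theorem stmt_1 (n k : ℕ) (hn : 3 ≤ n) (hk : 2 ≤ k) (hkn : k ≤ n)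
    (Em Ep : Set (Sym2 (Fin n))) (hmove : IsKMove n k Em Ep)
    (f : Fin k → Fin n) (hf : StrictMono f) (hEm : Em = EminusSet n k f) :
    (∃ M : Set (Sym2 (Fin (2 * k))),
        IsPerfectMatchingEdgeSet M ∧ Ep = EplusSet n k f M) ∧
      (∀ M : Set (Sym2 (Fin (2 * k))),
        IsPerfectMatchingEdgeSet M → Ep = EplusSet n k f M → IsValidPattern k M) := by
  have hk0 : 0 < k := by omega
  refine ⟨exists_perfectMatching_image_eq _ Ep hmove.2.2.2.1 fun x => ?_, fun M hM hEp => ⟨hM, ?_⟩⟩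
  · rw [ncard_endpointMap_fiber hn hf.injective, ← hEm, ncard_mem_eq_of_isKMove hn hmove]
  · have : Nonempty (Fin (2 * k)) := ⟨⟨0, by omega⟩⟩
    have hreach := reachable_segmentEnd hk0 hf M
    refine connected_of_adj_reachable hmove.2.2.2.2.preconnected (segmentEnd hk0 f)
      (endpointMap n k f) (fun x y hxy => ?_) hreach
    rcases ((SimpleGraph.fromEdgeSet_adj _).1 hxy).1 with ⟨⟨i, hi⟩, hnot⟩ | hmem
    · have hfi : ∀ j, f j ≠ i := by
        rintro j rfl
        exact hnot (hEm ▸ ⟨j, hi.symm⟩)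
      rcases Sym2.eq_iff.1 hi with ⟨rfl, h⟩ | ⟨rfl, h⟩
      · rw [segmentEnd_tourEdge hk0 hfi (congrArg Fin.val h).symm]
      · rw [segmentEnd_tourEdge hk0 hfi (congrArg Fin.val h).symm]
    · rw [hEp] at hmem
      obtain ⟨m, hm, hmxy⟩ := hmem
      induction m with | _ p q =>
      have hpq : (SimpleGraph.fromEdgeSet (M ∪ nuEdges k)).Reachable p q :=
        SimpleGraph.Adj.reachable ((SimpleGraph.fromEdgeSet_adj _).2
          ⟨Or.inl hm, fun h => hM.1 _ hm (by simpa using h)⟩)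
      have hends := ((hreach p).symm.trans hpq).trans (hreach q)
      rw [Sym2.map_mk] at hmxy
      rcases Sym2.eq_iff.1 hmxy with ⟨rfl, rfl⟩ | ⟨rfl, rfl⟩
      · exact hends
      · exact hends.symm
end

section
/- For every ε > 0 there exists an integer n_ε such that every multigraph G with n > n_ε vertices and m edges in which every vertex has degree at least 2 and at most 4 has pathwidth at most (m − n)/3 + ε·n. -/
/-- A multigraph is given by a vertex type `V`, an edge type `E` and an incidence
map `ends : E → V × V`.  The degree of `v` counts edge-endpoints at `v` (parallel
edges count with multiplicity, a loop contributes `2`). -/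
noncomputable def mdeg {V E : Type*} (ends : E → V × V) (v : V) : ℕ :=
  Nat.card {e : E // (ends e).1 = v} + Nat.card {e : E // (ends e).2 = v}

/-- The underlying simple graph of the multigraph `ends : E → V × V` (parallel
edges suppressed, loops discarded). -/
def underlyingSimple {V E : Type*} (ends : E → V × V) : SimpleGraph V :=
  SimpleGraph.fromRel (fun u v => ∃ e, ends e = (u, v) ∨ ends e = (v, u))

/-- `G` has pathwidth at most `w` (here `w : ℝ`): there is a path decomposition,
i.e. a sequence of bags covering all vertices and all edges such that every vertex
appears in an interval of bags, all of whose bags have size at most `w + 1`. -/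
def PathwidthAtMost {V : Type*} (G : SimpleGraph V) (w : ℝ) : Prop :=
  ∃ (r : ℕ) (X : Fin r → Finset V),
    (∀ v, ∃ t, v ∈ X t) ∧
    (∀ e ∈ G.edgeSet, ∃ t, ∀ v ∈ e, v ∈ X t) ∧
    (∀ (v : V) (t₁ t₂ t₃ : Fin r), t₁ ≤ t₂ → t₂ ≤ t₃ → v ∈ X t₁ → v ∈ X t₃ → v ∈ X t₂) ∧
    (∀ t, ((X t).card : ℝ) ≤ w + 1)

namespace PathwidthBound

open Finset

/-! ### Edge weights between vertex sets -/

section EdgeWeight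

variable {V : Type*} (w : V → V → ℕ)

/-- The number of edges from `v` into `T`, counted with multiplicity. -/
def rowWeight (v : V) (T : Finset V) : ℕ := ∑ u ∈ T, w v u

/-- The number of edges from `S` to `T`, counted with multiplicity as ordered pairs. -/
def edgeWeight (S T : Finset V) : ℕ := ∑ v ∈ S, rowWeight w v T

variable {w}

theorem rowWeight_mono (v : V) {S T : Finset V} (h : S ⊆ T) : rowWeight w v S ≤ rowWeight w v T :=
  sum_le_sum_of_subset h

theorem edgeWeight_mono {S S' T T' : Finset V} (hS : S ⊆ S') (hT : T ⊆ T') :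
    edgeWeight w S T ≤ edgeWeight w S' T' :=
  (sum_le_sum_of_subset hS).trans (sum_le_sum fun v _ => rowWeight_mono v hT)

theorem rowWeight_eq_zero {v : V} {T : Finset V} : rowWeight w v T = 0 ↔ ∀ u ∈ T, w v u = 0 := by
  simp [rowWeight]

theorem rowWeight_pos {v : V} {T : Finset V} : 0 < rowWeight w v T ↔ ∃ u ∈ T, 0 < w v u := by
  simp [Nat.pos_iff_ne_zero, Ne, rowWeight_eq_zero]

theorem edgeWeight_eq_zero {S T : Finset V} :
    edgeWeight w S T = 0 ↔ ∀ v ∈ S, ∀ u ∈ T, w v u = 0 := by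
  simp [edgeWeight, rowWeight_eq_zero]

theorem edgeWeight_pos {S T : Finset V} :
    0 < edgeWeight w S T ↔ ∃ v ∈ S, ∃ u ∈ T, 0 < w v u := by
  simp [Nat.pos_iff_ne_zero, Ne, edgeWeight_eq_zero]

theorem edgeWeight_comm (hw : ∀ u v, w u v = w v u) (S T : Finset V) :
    edgeWeight w S T = edgeWeight w T S := by
  unfold edgeWeight rowWeight
  rw [sum_comm]
  exact sum_congr rfl fun _ _ => sum_congr rfl fun _ _ => hw _ _

theorem le_rowWeight {v u : V} {T : Finset V} (hu : u ∈ T) : w v u ≤ rowWeight w v T :=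
  single_le_sum (f := fun u => w v u) (fun _ _ => Nat.zero_le _) hu

/-- The vertices of `S` with a neighbour in `T` are at most as many as the edges between them. -/
theorem card_filter_rowWeight_pos_le (S T : Finset V) :
    (S.filter fun v => 0 < rowWeight w v T).card ≤ edgeWeight w S T := by
  rw [card_filter]
  exact sum_le_sum fun v _ => by split_ifs <;> omega

variable [DecidableEq V]

theorem rowWeight_union (v : V) {S T : Finset V} (h : Disjoint S T) :
    rowWeight w v (S ∪ T) = rowWeight w v S + rowWeight w v T :=
  sum_union h

theorem rowWeight_add_sdiff (v : V) {S T : Finset V} (h : S ⊆ T) :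
    rowWeight w v S + rowWeight w v (T \ S) = rowWeight w v T := by
  rw [← rowWeight_union v disjoint_sdiff, union_sdiff_of_subset h]

theorem edgeWeight_union_left {S S' : Finset V} (h : Disjoint S S') (T : Finset V) :
    edgeWeight w (S ∪ S') T = edgeWeight w S T + edgeWeight w S' T :=
  sum_union h

theorem edgeWeight_union_right (S : Finset V) {T T' : Finset V} (h : Disjoint T T') :
    edgeWeight w S (T ∪ T') = edgeWeight w S T + edgeWeight w S T' := by
  simp only [edgeWeight, rowWeight_union _ h, sum_add_distrib]

theorem edgeWeight_add_sdiff_right (S : Finset V) {T T' : Finset V} (h : T ⊆ T') :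
    edgeWeight w S T + edgeWeight w S (T' \ T) = edgeWeight w S T' := by
  rw [← edgeWeight_union_right S disjoint_sdiff, union_sdiff_of_subset h]

theorem edgeWeight_add_sdiff_left {S S' : Finset V} (h : S ⊆ S') (T : Finset V) :
    edgeWeight w S T + edgeWeight w (S' \ S) T = edgeWeight w S' T := by
  rw [← edgeWeight_union_left disjoint_sdiff, union_sdiff_of_subset h]

theorem edgeWeight_self_split (hw : ∀ u v, w u v = w v u) {S C : Finset V} (h : S ⊆ C) :
    edgeWeight w C C =
      edgeWeight w S S + 2 * edgeWeight w S (C \ S) + edgeWeight w (C \ S) (C \ S) := by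
  have h1 := edgeWeight_add_sdiff_left (w := w) h C
  have h2 := edgeWeight_add_sdiff_right (w := w) S h
  have h3 := edgeWeight_add_sdiff_right (w := w) (C \ S) h
  have h4 := edgeWeight_comm hw (C \ S) S
  omega

end EdgeWeight

/-! ### Connected vertex sets -/

section Connected

variable {V : Type*} [DecidableEq V] (w : V → V → ℕ)

/-- No nonempty proper subset of `C` is separated from the rest of `C`. -/
def IsConn (C : Finset V) : Prop :=
  ∀ S ⊆ C, S.Nonempty → S ≠ C → 0 < edgeWeight w S (C \ S)

variable {w}

theorem IsConn.two_mul_card_le (hw : ∀ u v, w u v = w v u) {C : Finset V} (hC : IsConn w C) :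
    2 * C.card ≤ edgeWeight w C C + 2 := by
  rcases C.eq_empty_or_nonempty with rfl | ⟨v₀, hv₀⟩
  · simp
  have key : ∀ j, j + 1 ≤ C.card → ∃ S ⊆ C, S.card = j + 1 ∧ 2 * j ≤ edgeWeight w S S := by
    intro j
    induction j with
    | zero => exact fun _ => ⟨{v₀}, by simpa using hv₀, by simp, by simp⟩
    | succ j ih =>
      intro hj
      obtain ⟨S, hS, hcard, hle⟩ := ih (by omega)
      have hne : S ≠ C := by rintro rfl; omega
      obtain ⟨s, hs, t, ht, hst⟩ :=
        edgeWeight_pos.1 (hC S hS (card_pos.1 (by omega)) hne)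
      rw [mem_sdiff] at ht
      have hsub : S ⊆ insert t S := subset_insert _ _
      refine ⟨insert t S, insert_subset ht.1 hS, by rw [card_insert_of_notMem ht.2, hcard], ?_⟩
      have h1 := edgeWeight_self_split hw hsub
      have h2 : 0 < edgeWeight w S (insert t S \ S) :=
        edgeWeight_pos.2 ⟨s, hs, t, by simp [ht.2], hst⟩
      omega
  have hpos : 0 < C.card := card_pos.2 ⟨v₀, hv₀⟩
  obtain ⟨S, hS, hcard, hle⟩ := key (C.card - 1) (by omega)
  obtain rfl := eq_of_subset_of_card_le hS (by omega)
  omega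

/-- A nonempty set on which `φ` has nonnegative sum has a connected component with this property. -/
theorem exists_isConn_sum_nonneg (hw : ∀ u v, w u v = w v u) (φ : V → ℤ) {Z : Finset V}
    (hZ : Z.Nonempty) (hφ : 0 ≤ ∑ v ∈ Z, φ v) :
    ∃ D ⊆ Z, D.Nonempty ∧ edgeWeight w D (Z \ D) = 0 ∧ IsConn w D ∧ 0 ≤ ∑ v ∈ D, φ v := by
  classical
  have hne : (Z.powerset.filter fun D =>
      D.Nonempty ∧ edgeWeight w D (Z \ D) = 0 ∧ 0 ≤ ∑ v ∈ D, φ v).Nonempty :=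
    ⟨Z, by simp [hZ, hφ, edgeWeight_eq_zero]; exact fun _ _ _ h h' => absurd h h'⟩
  obtain ⟨D, hD, hmin⟩ := exists_min_image _ card hne
  simp only [mem_filter, mem_powerset] at hD hmin
  obtain ⟨hDZ, hDne, hDcl, hDφ⟩ := hD
  refine ⟨D, hDZ, hDne, hDcl, fun S hS hSne hSD => ?_, hDφ⟩
  by_contra h0
  have h0 : edgeWeight w S (D \ S) = 0 := by omega
  rw [edgeWeight_eq_zero] at hDcl h0
  have hlt : S.card < D.card := card_lt_card (hS.ssubset_of_ne hSD)
  have hsum := sum_sdiff (f := φ) hS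
  have hne' : (D \ S).Nonempty := by
    rw [sdiff_nonempty]
    exact fun h => hSD (hS.antisymm h)
  rcases le_or_gt 0 (∑ v ∈ S, φ v) with h | h
  · have := hmin S ⟨hS.trans hDZ, hSne, ?_, h⟩
    · omega
    · rw [edgeWeight_eq_zero]
      intro v hv u hu
      rw [mem_sdiff] at hu
      by_cases huD : u ∈ D
      · exact h0 v hv u (mem_sdiff.2 ⟨huD, hu.2⟩)
      · exact hDcl v (hS hv) u (mem_sdiff.2 ⟨hu.1, huD⟩)
  · have := hmin (D \ S) ⟨sdiff_subset.trans hDZ, hne', ?_, by omega⟩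
    · have := card_sdiff_of_subset hS
      have := hSne.card_pos
      omega
    · rw [edgeWeight_eq_zero]
      intro v hv u hu
      rw [mem_sdiff] at hu hv
      by_cases huD : u ∈ D
      · rw [hw]
        refine h0 u ?_ v (mem_sdiff.2 hv)
        by_contra huS
        exact hu.2 (mem_sdiff.2 ⟨huD, huS⟩)
      · exact hDcl v hv.1 u (mem_sdiff.2 ⟨hu.1, huD⟩)

/-- A connected set of at least `3 * k` vertices of degree at most `3` splits into two connected
sets with at least `k` vertices, one of which has fewer than `2 * k` vertices. -/
theorem IsConn.exists_split (hw : ∀ u v, w u v = w v u) {C : Finset V} (hC : IsConn w C)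
    (hdeg : ∀ v ∈ C, rowWeight w v C ≤ 3) {k : ℕ} (hk : 1 ≤ k) (hcard : 3 * k ≤ C.card) :
    ∃ S ⊆ C, IsConn w S ∧ IsConn w (C \ S) ∧ k ≤ S.card ∧ S.card < 2 * k ∧
      k ≤ (C \ S).card := by
  classical
  have hne : (C.powerset.filter fun S =>
      IsConn w S ∧ IsConn w (C \ S) ∧ k ≤ S.card).Nonempty := by
    refine ⟨C, ?_⟩
    simp only [mem_filter, mem_powerset, Subset.refl, true_and, sdiff_self]
    refine ⟨hC, fun S hS hne => ?_, by omega⟩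
    rw [subset_empty.1 hS] at hne
    simp at hne
  obtain ⟨S, hS, hmin⟩ := exists_min_image _ card hne
  simp only [mem_filter, mem_powerset] at hS hmin
  obtain ⟨hSC, hSconn, hSc, hSk⟩ := hS
  -- a root of `S`, adjacent to the rest of `C` if there is any
  obtain ⟨r, hrS, hr⟩ : ∃ r ∈ S, S ≠ C → 0 < rowWeight w r (C \ S) := by
    have hSne : S.Nonempty := card_pos.1 (by omega)
    by_cases h : S = C
    · exact hSne.imp fun r hr => ⟨hr, fun h' => absurd h h'⟩
    · obtain ⟨r, hr, u, hu, hru⟩ := edgeWeight_pos.1 (hC S hSC hSne h)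
      exact ⟨r, hr, fun _ => rowWeight_pos.2 ⟨u, hu, hru⟩⟩
  have hcomp : ∀ D ⊆ S.erase r, D.Nonempty → edgeWeight w D (S.erase r \ D) = 0 → IsConn w D →
      D.card < k ∧ 0 < rowWeight w r D := by
    intro D hD hDne hDcl hDconn
    have hDS : D ⊆ S := hD.trans (erase_subset _ _)
    have hrD : r ∉ D := fun h => by simpa using hD h
    rw [edgeWeight_eq_zero] at hDcl
    constructor
    · by_contra hDk
      have hlt : D.card < S.card :=
        card_lt_card (hDS.ssubset_of_ne fun h => hrD (h ▸ hrS))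
      refine absurd (hmin D ⟨hDS.trans hSC, hDconn, ?_, by omega⟩) (by omega)
      -- `C \ D` is connected
      have main : ∀ T ⊆ C \ D, T.Nonempty → r ∉ T → 0 < edgeWeight w T ((C \ D) \ T) := by
        intro T hT hTne hrT
        by_contra h0
        have h0 : edgeWeight w T ((C \ D) \ T) = 0 := by omega
        rw [edgeWeight_eq_zero] at h0
        have hTS : T ⊆ S := by
          by_contra hTS
          have hout : (T ∩ (C \ S)).Nonempty := by
            obtain ⟨t, ht, htS⟩ := not_subset.1 hTS
            exact ⟨t, by simp [ht, htS, (mem_sdiff.1 (hT ht)).1]⟩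
          by_cases hall : T ∩ (C \ S) = C \ S
          · have hSneC : S ≠ C := by
              rintro rfl
              simp at hout
            obtain ⟨u, hu, hru⟩ := rowWeight_pos.1 (hr hSneC)
            rw [← hall, mem_inter] at hu
            have := h0 u hu.1 r (by simp [hrD, hrT, hSC hrS])
            rw [hw] at this
            omega
          · obtain ⟨a, ha, b, hb, hab⟩ := edgeWeight_pos.1 (hSc _ inter_subset_right hout hall)
            simp only [mem_inter, mem_sdiff, not_and, not_not] at ha hb
            have := h0 a ha.1 b (by
              simp only [mem_sdiff]
              exact ⟨⟨hb.1.1, fun h => hb.1.2 (hDS h)⟩, fun h => hb.1.2 (hb.2 h hb.1.1)⟩)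
            omega
        have hTC : T ≠ C := fun h => hrT (h ▸ hSC hrS)
        obtain ⟨a, ha, b, hb, hab⟩ :=
          edgeWeight_pos.1 (hC T (hTS.trans hSC) hTne hTC)
        rw [mem_sdiff] at hb
        by_cases hbD : b ∈ D
        · have haD := (mem_sdiff.1 (hT ha)).2
          have := hDcl b hbD a (by
            simp only [mem_sdiff, mem_erase]
            exact ⟨⟨fun h => hrT (h ▸ ha), hTS ha⟩, haD⟩)
          rw [hw] at this
          omega
        · have := h0 a ha b (by simp [hb, hbD])
          omega
      intro T hT hTne hTD
      by_cases hrT : r ∈ T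
      · rw [edgeWeight_comm hw]
        have hne : ((C \ D) \ T).Nonempty := by
          rw [sdiff_nonempty]
          exact fun h => hTD (hT.antisymm h)
        have := main ((C \ D) \ T) sdiff_subset hne (by simp [hrT])
        rwa [Finset.sdiff_sdiff_eq_self hT] at this
      · exact main T hT hTne hrT
    · obtain ⟨a, ha, b, hb, hab⟩ :=
        edgeWeight_pos.1 (hSconn D hDS hDne fun h => hrD (h ▸ hrS))
      rw [mem_sdiff] at hb
      by_cases hbr : b = r
      · subst hbr
        exact rowWeight_pos.2 ⟨a, ha, by rwa [hw]⟩
      · have := hDcl a ha b (by simp [hb, hbr])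
        omega
  have hcount : ∀ m, ∀ Z ⊆ S.erase r, Z.card = m → edgeWeight w Z (S.erase r \ Z) = 0 →
      Z.card ≤ (k - 1) * rowWeight w r Z := by
    intro m
    induction m using Nat.strong_induction_on with
    | _ m ih =>
      intro Z hZ hm hcl
      rcases Z.eq_empty_or_nonempty with rfl | hZne
      · simp
      obtain ⟨D, hDZ, hDne, hDcl, hDconn, -⟩ :=
        exists_isConn_sum_nonneg hw (fun _ => 0) hZne (by simp)
      rw [edgeWeight_eq_zero] at hcl hDcl
      have hDcl' : edgeWeight w D (S.erase r \ D) = 0 := by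
        rw [edgeWeight_eq_zero]
        intro v hv u hu
        rw [mem_sdiff] at hu
        by_cases huZ : u ∈ Z
        · exact hDcl v hv u (mem_sdiff.2 ⟨huZ, hu.2⟩)
        · exact hcl v (hDZ hv) u (mem_sdiff.2 ⟨hu.1, huZ⟩)
      obtain ⟨h1, h2⟩ := hcomp D (hDZ.trans hZ) hDne hDcl' hDconn
      have hcardD := card_sdiff_of_subset hDZ
      have hDpos := hDne.card_pos
      have hDle := card_le_card hDZ
      have h3 := ih (Z \ D).card (by omega) (Z \ D) (sdiff_subset.trans hZ) rfl (by
        rw [edgeWeight_eq_zero]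
        intro v hv u hu
        rw [mem_sdiff] at hv hu
        by_cases huZ : u ∈ Z
        · rw [hw]
          refine hDcl u ?_ v (mem_sdiff.2 hv)
          by_contra huD
          exact hu.2 (mem_sdiff.2 ⟨huZ, huD⟩)
        · exact hcl v hv.1 u (mem_sdiff.2 ⟨hu.1, huZ⟩))
      have h4 := rowWeight_add_sdiff (w := w) r hDZ
      rw [← h4, mul_add]
      have h5 : D.card ≤ (k - 1) * rowWeight w r D :=
        (by omega : D.card ≤ (k - 1) * 1).trans (Nat.mul_le_mul_left _ h2)
      omega
  have hfin := hcount _ (S.erase r) Subset.rfl rfl (by simp [edgeWeight, rowWeight])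
  rw [card_erase_of_mem hrS] at hfin
  have hd := hdeg r (hSC hrS)
  have hmono : rowWeight w r (S.erase r) ≤ rowWeight w r S := rowWeight_mono r (erase_subset _ _)
  have hsplit := rowWeight_add_sdiff (w := w) r hSC
  have hSneC : S ≠ C := by
    rintro rfl
    have := Nat.mul_le_mul_left (k - 1) (hmono.trans hd)
    omega
  have hpos := hr hSneC
  have hlast := Nat.mul_le_mul_left (k - 1) (by omega : rowWeight w r (S.erase r) ≤ 2)
  have hle := card_sdiff_of_subset hSC
  exact ⟨S, hSC, hSconn, hSc, hSk, by omega, by omega⟩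

end Connected

/-! ### Sweeping a graph -/

section Sweep

variable {V : Type*} [DecidableEq V] (w : V → V → ℕ)

/-- A pair `(P, L)` of finished vertices `P` and visited vertices `L`, where the finished vertices
have no neighbours outside `L`. -/
def IsState (a : Finset V × Finset V) : Prop :=
  a.1 ⊆ a.2 ∧ ∀ u ∈ a.1, ∀ v ∉ a.2, w u v = 0

/-- A step between states in which at most `K` vertices are simultaneously active. -/
structure SweepStep (K : ℕ) (a b : Finset V × Finset V) : Prop where
  left : IsState w a
  right : IsState w b
  fst_subset : a.1 ⊆ b.1
  snd_subset : a.2 ⊆ b.2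
  card_le : (b.2 \ a.1).card ≤ K

/-- A sequence of steps between states in which at most `K` vertices are simultaneously active. -/
def Sweep (K : ℕ) : Finset V × Finset V → Finset V × Finset V → Prop :=
  Relation.ReflTransGen (SweepStep w K)

/-- Every vertex of `Z` lies in a union of connected components of `Z` with at most `b` vertices. -/
def HasPieces (b : ℕ) (Z : Finset V) : Prop :=
  ∀ v ∈ Z, ∃ D ⊆ Z, v ∈ D ∧ D.card ≤ b ∧ edgeWeight w D (Z \ D) = 0

variable {w}

theorem Sweep.mono {K K' : ℕ} (h : K ≤ K') {a b : Finset V × Finset V} (hab : Sweep w K a b) :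
    Sweep w K' a b :=
  Relation.ReflTransGen.mono (fun _ _ hs =>
    ⟨hs.left, hs.right, hs.fst_subset, hs.snd_subset, hs.card_le.trans h⟩) _ _ hab

theorem SweepStep.sweep {K : ℕ} {a b : Finset V × Finset V} (h : SweepStep w K a b) :
    Sweep w K a b :=
  Relation.ReflTransGen.single h

theorem IsState.compl [Fintype V] (hw : ∀ u v, w u v = w v u) {a : Finset V × Finset V}
    (h : IsState w a) : IsState w (a.2ᶜ, a.1ᶜ) :=
  ⟨compl_subset_compl.2 h.1, fun u hu v hv => by
    rw [hw]
    exact h.2 v (by simpa using hv) u (by simpa using hu)⟩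

theorem Sweep.compl [Fintype V] (hw : ∀ u v, w u v = w v u) {K : ℕ} {a b : Finset V × Finset V}
    (h : Sweep w K a b) : Sweep w K (b.2ᶜ, b.1ᶜ) (a.2ᶜ, a.1ᶜ) := by
  induction h with
  | refl => exact .refl
  | tail _ h ih =>
    refine .head ⟨h.right.compl hw, h.left.compl hw, compl_subset_compl.2 h.snd_subset,
      compl_subset_compl.2 h.fst_subset, ?_⟩ ih
    convert h.card_le using 2
    ext v
    simp [and_comm]

theorem HasPieces.sdiff {b : ℕ} {Z : Finset V} (h : HasPieces w b Z) (D : Finset V) :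
    HasPieces w b (Z \ D) := by
  intro v hv
  rw [mem_sdiff] at hv
  obtain ⟨D', hD', hvD', hcard, hcl⟩ := h v hv.1
  rw [edgeWeight_eq_zero] at hcl
  refine ⟨D' \ D, sdiff_subset_sdiff hD' Subset.rfl, mem_sdiff.2 ⟨hvD', hv.2⟩,
    (card_le_card sdiff_subset).trans hcard, edgeWeight_eq_zero.2 fun u hu x hx => ?_⟩
  simp only [mem_sdiff, not_and, not_not] at hu hx
  exact hcl u hu.1 x (mem_sdiff.2 ⟨hx.1.1, fun h => hx.1.2 (hx.2 h)⟩)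

theorem sweep_of_hasPieces {b : ℕ} :
    ∀ (m : ℕ) {P L Z : Finset V}, Z.card = m → IsState w (P, L) →
      (∀ u ∈ Z, ∀ v ∉ L ∪ Z, w u v = 0) → HasPieces w b Z →
      Sweep w ((L \ P).card + b) (P, L) (P ∪ Z, L ∪ Z) := by
  intro m
  induction m using Nat.strong_induction_on with
  | _ m ih =>
    intro P L Z hm hst hcl hZ
    rcases Z.eq_empty_or_nonempty with rfl | ⟨v, hv⟩
    · rw [union_empty, union_empty]
      exact .refl
    obtain ⟨D, hD, hvD, hcard, hDcl⟩ := hZ v hv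
    have hDcl' := edgeWeight_eq_zero.1 hDcl
    have hst' : IsState w (P ∪ D, L ∪ D) := by
      refine ⟨union_subset_union hst.1 Subset.rfl, fun u hu x hx => ?_⟩
      simp only [mem_union, not_or] at hu hx
      rcases hu with hu | hu
      · exact hst.2 u hu x hx.1
      · by_cases hxZ : x ∈ Z
        · exact hDcl' u hu x (mem_sdiff.2 ⟨hxZ, hx.2⟩)
        · exact hcl u (hD hu) x (by simp [hx.1, hxZ])
    have hlt : (Z \ D).card < m := hm ▸ card_lt_card
      (Finset.ssubset_iff_subset_ne.2 ⟨sdiff_subset, fun h => (mem_sdiff.1 (h ▸ hv)).2 hvD⟩)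
    have hrest := ih _ hlt (P := P ∪ D) (L := L ∪ D) rfl hst' (fun u hu x hx => by
      simp only [mem_union, mem_sdiff, not_or, not_and, not_not] at hu hx
      exact hcl u hu.1 x (by
        simp only [mem_union, not_or]
        exact ⟨hx.1.1, fun h => hx.1.2 (hx.2 h)⟩)) (hZ.sdiff D)
    rw [union_assoc, union_assoc, union_sdiff_of_subset hD] at hrest
    refine .head ⟨hst, hst', subset_union_left, subset_union_left, ?_⟩ (hrest.mono ?_)
    · calc ((L ∪ D) \ P).card ≤ ((L \ P) ∪ D).card := card_le_card fun x => by
            simp only [mem_union, mem_sdiff]; tauto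
        _ ≤ _ := (card_union_le _ _).trans (by omega)
    · have : ((L ∪ D) \ (P ∪ D)).card ≤ (L \ P).card := card_le_card fun x => by
        simp only [mem_union, mem_sdiff]; tauto
      omega

/-- A set of unvisited vertices without further unvisited neighbours can be finished by keeping a
separator `Q` of it active. -/
theorem sweep_of_separator {b : ℕ} {P L C Q : Finset V}
    (hst : IsState w (P, L)) (hcl : ∀ u ∈ C, ∀ v ∉ L ∪ C, w u v = 0) (hQ : Q ⊆ C)
    (hpieces : HasPieces w b (C \ Q)) :
    Sweep w ((L \ P).card + Q.card + b) (P, L) (P ∪ C, L ∪ C) := by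
  have hst₁ : IsState w (P, L ∪ Q) :=
    ⟨hst.1.trans subset_union_left, fun u hu v hv => hst.2 u hu v (by simp at hv; tauto)⟩
  have hcard : ((L ∪ Q) \ P).card ≤ (L \ P).card + Q.card :=
    (card_le_card fun x => by simp only [mem_union, mem_sdiff]; tauto).trans (card_union_le _ _)
  have hLC : L ∪ Q ∪ C \ Q = L ∪ C := by rw [union_assoc, union_sdiff_of_subset hQ]
  have h₂ := sweep_of_hasPieces _ (P := P) (L := L ∪ Q) (Z := C \ Q) rfl hst₁
    (fun u hu v hv => hcl u (mem_sdiff.1 hu).1 v (hLC ▸ hv)) hpieces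
  rw [hLC] at h₂
  have hst₂ : IsState w (P ∪ C \ Q, L ∪ C) := by
    refine ⟨union_subset_union hst.1 sdiff_subset, fun u hu v hv => ?_⟩
    rcases mem_union.1 hu with hu | hu
    · exact hst.2 u hu v (by simp at hv; tauto)
    · exact hcl u (mem_sdiff.1 hu).1 v hv
  have hst₃ : IsState w (P ∪ C, L ∪ C) := by
    refine ⟨union_subset_union hst.1 Subset.rfl, fun u hu v hv => ?_⟩
    rcases mem_union.1 hu with hu | hu
    · exact hst.2 u hu v (by simp at hv; tauto)
    · exact hcl u hu v hv
  refine .head ⟨hst, hst₁, Subset.rfl, subset_union_left, by dsimp only; omega⟩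
    (.tail (h₂.mono (by omega)) ⟨hst₂, hst₃, union_subset_union Subset.rfl sdiff_subset,
      Subset.rfl, ?_⟩)
  have : ((L ∪ C) \ (P ∪ C \ Q)).card ≤ ((L \ P) ∪ Q).card := card_le_card fun x => by
    simp only [mem_union, mem_sdiff]; tauto
  have := card_union_le (L \ P) Q
  dsimp only
  omega

/-- Connected sets with few edges have small separators into bounded pieces. -/
theorem IsConn.exists_separator (hw : ∀ u v, w u v = w v u) {k : ℕ} (hk : 1 ≤ k) :
    ∀ (m : ℕ) {C : Finset V}, C.card = m → IsConn w C → (∀ v ∈ C, rowWeight w v C ≤ 3) →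
      ∃ Q ⊆ C, HasPieces w (3 * k) (C \ Q) ∧
        2 * k * Q.card + 2 * k * C.card ≤ k * edgeWeight w C C + 2 * C.card + 2 * k := by
  intro m
  induction m using Nat.strong_induction_on with
  | _ m ih =>
    intro C hm hC hdeg
    rcases lt_or_ge C.card (3 * k) with hlt | hge
    · refine ⟨∅, by simp, fun v hv => ⟨C, by simp, by simpa using hv, hlt.le, ?_⟩, ?_⟩
      · rw [sdiff_empty, edgeWeight_eq_zero]
        simp
      · have := Nat.mul_le_mul_left k (hC.two_mul_card_le hw)
        simp only [card_empty]
        linarith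
    obtain ⟨S, hSC, hS, hS', hkS, hSk, hkS'⟩ := hC.exists_split hw hdeg hk hge
    have hcard := card_sdiff_add_card_eq_card hSC
    obtain ⟨Q', hQ', hpieces, hQ'card⟩ := ih (C \ S).card (by omega) rfl hS' fun v hv =>
      (rowWeight_mono v sdiff_subset).trans (hdeg v (sdiff_subset hv))
    set B := S.filter fun v => 0 < rowWeight w v (C \ S) with hB
    have hBcard : B.card ≤ edgeWeight w S (C \ S) := card_filter_rowWeight_pos_le _ _
    have hBS : B ⊆ S := filter_subset _ _
    have hBzero : ∀ u ∈ S, u ∉ B → ∀ x ∈ C, x ∉ S → w u x = 0 := by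
      intro u hu huB x hx hxS
      have h0 : rowWeight w u (C \ S) = 0 := by
        by_contra h
        exact huB (mem_filter.2 ⟨hu, by omega⟩)
      exact rowWeight_eq_zero.1 h0 x (mem_sdiff.2 ⟨hx, hxS⟩)
    refine ⟨Q' ∪ B, union_subset (hQ'.trans sdiff_subset) (hBS.trans hSC), ?_, ?_⟩
    · intro v hv
      simp only [mem_sdiff, mem_union, not_or] at hv
      by_cases hvS : v ∈ S
      · refine ⟨S \ B, ?_, by simp [hvS, hv.2.2], (card_le_card sdiff_subset).trans (by omega), ?_⟩
        · intro x hx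
          rw [mem_sdiff] at hx
          simp only [mem_sdiff, mem_union, not_or]
          exact ⟨hSC hx.1, fun h => (mem_sdiff.1 (hQ' h)).2 hx.1, hx.2⟩
        · rw [edgeWeight_eq_zero]
          intro u hu x hx
          simp only [mem_sdiff, mem_union, not_or, not_and, not_not] at hu hx
          exact hBzero u hu.1 hu.2 x hx.1.1 fun h => hx.1.2.2 (hx.2 h)
      · obtain ⟨D, hD, hvD, hDcard, hDcl⟩ := hpieces v (by simp [hv, hvS])
        rw [edgeWeight_eq_zero] at hDcl
        refine ⟨D, ?_, hvD, hDcard, ?_⟩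
        · intro x hx
          have hx := hD hx
          simp only [mem_sdiff, mem_union, not_or] at hx ⊢
          exact ⟨hx.1.1, hx.2, fun h => hx.1.2 (hBS h)⟩
        · rw [edgeWeight_eq_zero]
          intro u hu x hx
          simp only [mem_sdiff, mem_union, not_or] at hx
          by_cases hxS : x ∈ S
          · have hu' := hD hu
            simp only [mem_sdiff] at hu'
            rw [hw]
            exact hBzero x hxS hx.1.2.2 u hu'.1.1 hu'.1.2
          · exact hDcl u hu x (by simp [hx, hxS])
    · have h1 := card_union_le Q' B
      have h2 := edgeWeight_self_split hw hSC
      have h3 := hS.two_mul_card_le hw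
      rw [h2]
      have h4 := Nat.mul_le_mul_left (2 * k) (h1.trans (Nat.add_le_add_left hBcard _))
      have h5 := Nat.mul_le_mul_left k h3
      rw [← hcard]
      ring_nf at *
      linarith

/-- The number of vertices of degree `3` in `S`. -/
def cubicCount [Fintype V] (w : V → V → ℕ) (S : Finset V) : ℕ :=
  (S.filter fun v => rowWeight w v univ = 3).card

omit [DecidableEq V] in
theorem sum_rowWeight_univ [Fintype V]
    (hdeg : ∀ v, rowWeight w v univ = 2 ∨ rowWeight w v univ = 3) (S : Finset V) :
    edgeWeight w S univ = 2 * S.card + cubicCount w S := by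
  unfold edgeWeight cubicCount
  rw [card_filter, mul_comm, ← smul_eq_mul, ← sum_const, ← sum_add_distrib]
  refine sum_congr rfl fun v _ => ?_
  rcases hdeg v with h | h <;> simp [h]

theorem cubicCount_union [Fintype V] {S T : Finset V} (h : Disjoint S T) :
    cubicCount w (S ∪ T) = cubicCount w S + cubicCount w T := by
  unfold cubicCount
  rw [filter_union, card_union_of_disjoint (disjoint_filter_filter h)]

omit [DecidableEq V] in
theorem cubicCount_mono [Fintype V] {S T : Finset V} (h : S ⊆ T) :
    cubicCount w S ≤ cubicCount w T :=
  card_le_card (filter_subset_filter _ h)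

/-- From a state in which at most `K` vertices are active and at most `3 * K` vertices of degree `3`
are unfinished, the sweep can be completed with little more than `K` active vertices. -/
theorem sweep_to_univ [Fintype V] (hw : ∀ u v, w u v = w v u)
    (hdeg : ∀ v, rowWeight w v univ = 2 ∨ rowWeight w v univ = 3) {k : ℕ} (hk : 1 ≤ k) (K : ℕ) :
    ∀ (m : ℕ) {P L : Finset V}, Pᶜ.card + Lᶜ.card = m → IsState w (P, L) → (L \ P).card ≤ K →
      cubicCount w Pᶜ ≤ 3 * K →
      (∀ x ∈ L \ P, rowWeight w x Lᶜ ≤ 1 ∨ rowWeight w x univ = 3) →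
      Sweep w (K + (Fintype.card V / k + 1) + 3 * k) (P, L) (univ, univ) := by
  generalize hq : Fintype.card V / k = q
  intro m
  induction m using Nat.strong_induction_on with
  | _ m ih =>
  intro P L hm hst hX hμ hinv
  by_cases hP : P = univ
  · obtain rfl : L = univ := univ_subset_iff.1 (hP ▸ hst.1)
    subst hP
    exact .refl
  have hcompl : ∀ {S T : Finset V}, S ⊆ T → Tᶜ.card ≤ Sᶜ.card := fun h =>
    card_le_card (compl_subset_compl.2 h)
  have hcompl_lt : ∀ {S T : Finset V}, S ⊂ T → Tᶜ.card < Sᶜ.card := fun h =>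
    card_lt_card (compl_ssubset_compl.2 h)
  by_cases h0 : ∃ x ∈ L \ P, rowWeight w x Lᶜ = 0
  · obtain ⟨x, hx, hx0⟩ := h0
    rw [mem_sdiff] at hx
    rw [rowWeight_eq_zero] at hx0
    have hst' : IsState w (insert x P, L) := by
      refine ⟨insert_subset hx.1 hst.1, fun u hu v hv => ?_⟩
      rcases mem_insert.1 hu with rfl | hu
      · exact hx0 v (by simpa using hv)
      · exact hst.2 u hu v hv
    have hlt := hcompl_lt (ssubset_insert hx.2)
    refine .head ⟨hst, hst', subset_insert _ _, Subset.rfl, by dsimp only; omega⟩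
      (ih _ (by omega) rfl hst' ?_ ((cubicCount_mono ?_).trans hμ) fun y hy => hinv y ?_)
    · exact (card_le_card (sdiff_subset_sdiff Subset.rfl (subset_insert _ _))).trans hX
    · exact compl_subset_compl.2 (subset_insert _ _)
    · exact sdiff_subset_sdiff Subset.rfl (subset_insert _ _) hy
  by_cases h1 : ∃ x ∈ L \ P, rowWeight w x Lᶜ = 1
  · obtain ⟨x, hx, hx1⟩ := h1
    rw [mem_sdiff] at hx
    obtain ⟨y, hy, hxy⟩ := rowWeight_pos.1 (by omega : 0 < rowWeight w x Lᶜ)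
    have hyL : y ∉ L := by simpa using hy
    have hrest : ∀ v, v ∉ L → v ≠ y → w x v = 0 := by
      intro v hv hvy
      have h2 : ({y, v} : Finset V) ⊆ Lᶜ := by
        intro z hz
        simp only [mem_insert, mem_singleton] at hz
        rcases hz with rfl | rfl <;> simpa
      have h3 := rowWeight_mono (w := w) x h2
      rw [rowWeight, sum_pair hvy.symm] at h3
      omega
    have hst' : IsState w (insert x P, insert y L) := by
      refine ⟨insert_subset (mem_insert_of_mem hx.1) (hst.1.trans (subset_insert _ _)),
        fun u hu v hv => ?_⟩
      simp only [mem_insert, not_or] at hu hv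
      rcases hu with rfl | hu
      · exact hrest v hv.2 hv.1
      · exact hst.2 u hu v hv.2
    have hlt := hcompl_lt (ssubset_insert hx.2)
    have hle := hcompl (subset_insert y L)
    have hyx : y ≠ x := fun h => hyL (h ▸ hx.1)
    have hyP : y ∉ P := fun h => hyL (hst.1 h)
    have hX1 : (insert y L \ P).card = (L \ P).card + 1 := by
      rw [insert_sdiff_of_notMem _ hyP, card_insert_of_notMem (by simp [hyL])]
    have hX2 : (insert y L \ insert x P).card = (L \ P).card := by
      rw [sdiff_insert, card_erase_of_mem (by simp [hx]), hX1]
      rfl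
    refine .head ⟨hst, hst', subset_insert _ _, subset_insert _ _, by dsimp only; omega⟩
      (ih _ (by omega) rfl hst' (by omega) ((cubicCount_mono ?_).trans hμ) fun z hz => ?_)
    · exact compl_subset_compl.2 (subset_insert _ _)
    · simp only [mem_sdiff, mem_insert, not_or] at hz
      have hmono := rowWeight_mono (w := w) z (compl_subset_compl.2 (subset_insert y L))
      by_cases hzy : z = y
      · subst hzy
        have hadd := rowWeight_union (w := w) z (disjoint_compl_right (a := L))
        rw [union_compl] at hadd
        have : 0 < rowWeight w z L := rowWeight_pos.2 ⟨x, hx.1, by rwa [hw]⟩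
        have := hdeg z
        omega
      · have := hinv z (by simp only [mem_sdiff]; tauto)
        omega
  push Not at h0 h1
  have h2 : ∀ x ∈ L \ P, 2 ≤ rowWeight w x Lᶜ := fun x hx => by
    have := h0 x hx
    have := h1 x hx
    omega
  have h3 : ∀ x ∈ L \ P, rowWeight w x univ = 3 := fun x hx => by
    have := h2 x hx
    have := hinv x hx
    omega
  have hXc : 2 * (L \ P).card ≤ edgeWeight w (L \ P) Lᶜ := by
    rw [mul_comm, ← smul_eq_mul]
    exact card_nsmul_le_sum _ _ _ h2
  have hXμ : cubicCount w (L \ P) = (L \ P).card := by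
    rw [cubicCount, filter_true_of_mem h3]
  have hdisj : Disjoint (L \ P) Lᶜ := disjoint_compl_right.mono_left sdiff_subset
  have hPc : Pᶜ = (L \ P) ∪ Lᶜ := by
    ext v
    have := @hst.1 v
    simp only [mem_compl, mem_union, mem_sdiff]
    tauto
  have hμ' := cubicCount_union (w := w) hdisj
  rw [← hPc] at hμ'
  have hYne : Lᶜ.Nonempty := by
    by_contra hY
    rw [not_nonempty_iff_eq_empty] at hY
    rw [hY] at hPc hXc
    have : edgeWeight w (L \ P) ∅ = 0 := by simp [edgeWeight_eq_zero]
    have h4 : L \ P = ∅ := card_eq_zero.1 (by omega)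
    rw [h4] at hPc
    simp at hPc
    exact hP hPc
  by_cases hc : cubicCount w Lᶜ ≤ edgeWeight w (L \ P) Lᶜ
  · have hYP : edgeWeight w Lᶜ P = 0 := by
      rw [edgeWeight_eq_zero]
      intro v hv u hu
      rw [hw]
      exact hst.2 u hu v (by simpa using hv)
    have hYY : edgeWeight w Lᶜ Lᶜ + edgeWeight w (L \ P) Lᶜ = 2 * Lᶜ.card + cubicCount w Lᶜ := by
      have e1 := edgeWeight_union_right (w := w) Lᶜ (disjoint_compl_right (a := L))
      have e2 := edgeWeight_add_sdiff_right (w := w) Lᶜ (show P ⊆ L from hst.1)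
      have e3 := edgeWeight_comm hw (L \ P) Lᶜ
      rw [union_compl, sum_rowWeight_univ hdeg] at e1
      omega
    obtain ⟨C, hC, hCne, hCcl, hCconn, hCφ⟩ := exists_isConn_sum_nonneg hw
      (fun v => 2 - (rowWeight w v Lᶜ : ℤ)) hYne (by
        rw [sum_sub_distrib, sum_const, ← Nat.cast_sum]
        change 0 ≤ _ - (edgeWeight w Lᶜ Lᶜ : ℤ)
        rw [nsmul_eq_mul]
        omega)
    rw [sum_sub_distrib, sum_const, ← Nat.cast_sum, nsmul_eq_mul] at hCφ
    change 0 ≤ _ - (edgeWeight w C Lᶜ : ℤ) at hCφ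
    have hCC := edgeWeight_add_sdiff_right (w := w) C hC
    obtain ⟨Q, hQ, hpieces, hQcard⟩ := hCconn.exists_separator hw hk _ rfl fun v _ =>
      (rowWeight_mono v (subset_univ C)).trans (by have := hdeg v; omega)
    have hQk : Q.card ≤ q + 1 := by
      rw [← hq]
      have e1 : edgeWeight w C C ≤ 2 * C.card := by omega
      have e2 := Nat.mul_le_mul_left k e1
      have e3 : C.card ≤ Fintype.card V := card_le_univ C
      have e4 : k * Q.card ≤ Fintype.card V + k := by
        have : 2 * (k * Q.card) ≤ 2 * (C.card + k) := by linarith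
        omega
      rw [← Nat.add_div_right _ (by omega), Nat.le_div_iff_mul_le (by omega)]
      rwa [mul_comm]
    rw [edgeWeight_eq_zero] at hCcl
    have hclosed : ∀ u ∈ C, ∀ v ∉ L ∪ C, w u v = 0 := fun u hu v hv =>
      hCcl u hu v (by simpa using hv)
    have hsweep := sweep_of_separator hst hclosed hQ hpieces
    have hst' : IsState w (P ∪ C, L ∪ C) := by
      refine ⟨union_subset_union hst.1 Subset.rfl, fun u hu v hv => ?_⟩
      rcases mem_union.1 hu with hu | hu
      · exact hst.2 u hu v (by simp at hv; tauto)
      · exact hclosed u hu v hv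
    have hCL : ∀ x ∈ C, x ∉ L := fun x hx => by simpa using hC hx
    have hlt : (L ∪ C)ᶜ.card < Lᶜ.card := hcompl_lt (by
      refine Finset.ssubset_iff_subset_ne.2 ⟨subset_union_left, fun h => ?_⟩
      obtain ⟨x, hx⟩ := hCne
      exact hCL x hx (by rw [h]; exact mem_union_right _ hx))
    have hle := hcompl (subset_union_left (s₁ := P) (s₂ := C))
    have hX' : (L ∪ C) \ (P ∪ C) ⊆ L \ P := fun x => by
      simp only [mem_union, mem_sdiff]; tauto
    refine (hsweep.mono (by omega)).trans (ih _ (by omega) rfl hst'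
      ((card_le_card hX').trans hX) ((cubicCount_mono ?_).trans hμ) fun z hz => ?_)
    · exact compl_subset_compl.2 subset_union_left
    · exact Or.inr (h3 z (hX' hz))
  · obtain ⟨y, hy⟩ : (Lᶜ.filter fun v => rowWeight w v univ = 3).Nonempty := by
      apply card_pos.1
      change 0 < cubicCount w Lᶜ
      omega
    rw [mem_filter, mem_compl] at hy
    have hst' : IsState w (P, insert y L) :=
      ⟨hst.1.trans (subset_insert _ _), fun u hu v hv => hst.2 u hu v (by simp at hv; tauto)⟩
    have hyP : y ∉ P := fun h => hy.1 (hst.1 h)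
    have hX1 : (insert y L \ P).card = (L \ P).card + 1 := by
      rw [insert_sdiff_of_notMem _ hyP, card_insert_of_notMem (by simp [hy.1])]
    have hlt := hcompl_lt (ssubset_insert hy.1)
    refine .head ⟨hst, hst', Subset.rfl, subset_insert _ _, by dsimp only; omega⟩
      (ih _ (by omega) rfl hst' (by omega) hμ fun z hz => ?_)
    right
    rw [insert_sdiff_of_notMem _ hyP, mem_insert] at hz
    rcases hz with rfl | hz
    · exact hy.2
    · exact h3 z hz

end Sweep

/-! ### Locally optimal cuts -/

section LocalCut

variable {V : Type*} [DecidableEq V] {w : V → V → ℕ}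

/-- A connected set with nonnegative total charge has a connected subset of bounded size with
nonnegative total charge. -/
theorem IsConn.exists_small_sum_nonneg (hw : ∀ u v, w u v = w v u) {k : ℕ} (hk : 1 ≤ k)
    (φ : V → ℤ) {C : Finset V} (hC : IsConn w C) (hdeg : ∀ v ∈ C, rowWeight w v C ≤ 3)
    (hcard : k ≤ C.card) (hφ : 0 ≤ ∑ v ∈ C, φ v) :
    ∃ S ⊆ C, IsConn w S ∧ k ≤ S.card ∧ S.card < 3 * k ∧ 0 ≤ ∑ v ∈ S, φ v := by
  classical
  have hne : (C.powerset.filter fun S =>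
      IsConn w S ∧ k ≤ S.card ∧ 0 ≤ ∑ v ∈ S, φ v).Nonempty :=
    ⟨C, by simp [hC, hcard, hφ]⟩
  obtain ⟨S, hS, hmin⟩ := exists_min_image _ Finset.card hne
  simp only [mem_filter, mem_powerset, and_imp] at hS hmin
  refine ⟨S, hS.1, hS.2.1, hS.2.2.1, ?_, hS.2.2.2⟩
  by_contra hge
  obtain ⟨T, hT, hT₁, hT₂, hkT, -, hkT'⟩ := hS.2.1.exists_split hw
    (fun v hv => (rowWeight_mono v hS.1).trans (hdeg v (hS.1 hv))) hk (not_lt.1 hge)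
  have hsum := sum_sdiff (f := φ) hT
  have hc := card_sdiff_add_card_eq_card hT
  rcases le_or_gt 0 (∑ v ∈ T, φ v) with h | h
  · have := hmin T (hT.trans hS.1) hT₁ hkT h
    omega
  · have := hmin (S \ T) (sdiff_subset.trans hS.1) hT₂ hkT' (by linarith [hS.2.2.2])
    omega

/-- The neighbours of `T` inside `A`. -/
def nbrs (w : V → V → ℕ) (A T : Finset V) : Finset V :=
  A.filter fun v => 0 < rowWeight w v T

omit [DecidableEq V] in
theorem mem_nbrs {A T : Finset V} {v : V} :
    v ∈ nbrs w A T ↔ v ∈ A ∧ ∃ u ∈ T, 0 < w v u := by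
  rw [nbrs, mem_filter, rowWeight_pos]

omit [DecidableEq V] in
theorem card_nbrs_le [Fintype V] (hw : ∀ u v, w u v = w v u)
    (hdeg : ∀ v, rowWeight w v univ ≤ 3) (A T : Finset V) :
    (nbrs w A T).card ≤ 3 * T.card := by
  refine (card_filter_rowWeight_pos_le A T).trans ?_
  rw [edgeWeight_comm hw, mul_comm, ← smul_eq_mul]
  exact sum_le_card_nsmul _ _ _ fun v _ => (rowWeight_mono v (subset_univ A)).trans (hdeg v)

/-- The vertices of `R` in a subset of `R` with fewer than `k` vertices and without edges to the
rest of `R`. -/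
def smallPart (w : V → V → ℕ) (k : ℕ) (R : Finset V) : Finset V :=
  open Classical in
  R.filter fun v => ∃ C ⊆ R, v ∈ C ∧ C.card < k ∧ edgeWeight w C (R \ C) = 0

theorem smallPart_subset (k : ℕ) (R : Finset V) : smallPart w k R ⊆ R := filter_subset _ _

theorem mem_smallPart {k : ℕ} {R : Finset V} {v : V} :
    v ∈ smallPart w k R ↔ ∃ C ⊆ R, v ∈ C ∧ C.card < k ∧ edgeWeight w C (R \ C) = 0 := by
  rw [smallPart, mem_filter, and_iff_right_iff_imp]
  rintro ⟨C, hC, hv, -⟩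
  exact hC hv

/-- There are no edges between the small and the big components of `R`. -/
theorem weight_smallPart_eq_zero {k : ℕ} {R : Finset V} {u x : V} (hu : u ∈ smallPart w k R)
    (hx : x ∈ R \ smallPart w k R) : w u x = 0 := by
  obtain ⟨C, hC, huC, hcard, hcl⟩ := mem_smallPart.1 hu
  rw [mem_sdiff] at hx
  exact edgeWeight_eq_zero.1 hcl u huC x
    (mem_sdiff.2 ⟨hx.1, fun h => hx.2 (mem_smallPart.2 ⟨C, hC, h, hcard, hcl⟩)⟩)

theorem le_card_of_closed (hw : ∀ u v, w u v = w v u) {k : ℕ} {R C : Finset V}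
    (hC : C ⊆ R \ smallPart w k R) (hne : C.Nonempty)
    (hcl : edgeWeight w C ((R \ smallPart w k R) \ C) = 0) : k ≤ C.card := by
  by_contra hlt
  obtain ⟨v, hv⟩ := hne
  have hv' := mem_sdiff.1 (hC hv)
  refine hv'.2 (mem_smallPart.2 ⟨C, hC.trans sdiff_subset, hv, not_le.1 hlt,
    edgeWeight_eq_zero.2 fun u hu x hx => ?_⟩)
  rw [mem_sdiff] at hx
  by_cases hxU : x ∈ smallPart w k R
  · rw [hw]
    exact weight_smallPart_eq_zero hxU (hC hu)
  · exact edgeWeight_eq_zero.1 hcl u hu x (by simp [hx, hxU])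

/-- A set of boundary vertices together with the nearby small components. -/
theorem exists_hull [Fintype V] (hw : ∀ u v, w u v = w v u) (hdeg : ∀ v, rowWeight w v univ ≤ 3)
    (k : ℕ) {D R N : Finset V} (hN : N ⊆ D) :
    ∃ W ⊆ smallPart w k R, ∃ M ⊆ D, N ⊆ M ∧ W.card + M.card ≤ N.card * (12 * k + 4) ∧
      (∀ u ∈ W, ∀ x ∈ R, x ∉ W → w u x = 0) ∧ (∀ u ∈ W, ∀ x ∈ D, x ∉ M → w u x = 0) ∧
      (∀ d ∈ N, ∀ x ∈ smallPart w k R, x ∉ W → w d x = 0) ∧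
      (∀ d ∈ N, ∀ x ∈ D, x ∉ M → w d x = 0) ∧
      ∀ d ∈ M, d ∉ N → ∃ x ∈ W ∪ M, 0 < w d x := by
  choose! C hC using fun (v : V) (hv : v ∈ smallPart w k R) => mem_smallPart.1 hv
  set W := (nbrs w (smallPart w k R) N).biUnion C with hW
  have hWmem : ∀ x, x ∈ W ↔ ∃ u ∈ smallPart w k R, (∃ d ∈ N, 0 < w u d) ∧ x ∈ C u := by
    intro x
    simp only [hW, mem_biUnion, mem_nbrs, and_assoc]
  have hsub : W ⊆ smallPart w k R := by
    intro x hx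
    obtain ⟨u, hu, -, hxu⟩ := (hWmem x).1 hx
    obtain ⟨h1, h2, h3, h4⟩ := hC u hu
    exact mem_smallPart.2 ⟨C u, h1, hxu, h3, h4⟩
  have hWcard : W.card ≤ 3 * N.card * k :=
    (card_biUnion_le_card_mul _ _ _ fun u hu => (hC u (mem_nbrs.1 hu).1).2.2.1.le).trans
      (Nat.mul_le_mul_right k (card_nbrs_le hw hdeg _ _))
  refine ⟨W, hsub, N ∪ nbrs w D N ∪ nbrs w D W, ?_, ?_, ?_, ?_, ?_, ?_, ?_, ?_⟩
  · exact union_subset (union_subset hN (filter_subset _ _)) (filter_subset _ _)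
  · exact subset_union_left.trans subset_union_left
  · have h1 := card_union_le (N ∪ nbrs w D N) (nbrs w D W)
    have h2 := card_union_le N (nbrs w D N)
    have h3 := card_nbrs_le hw hdeg D N
    have h4 := card_nbrs_le hw hdeg D W
    nlinarith
  · intro u hu x hx hxW
    obtain ⟨u', hu', hd, huC⟩ := (hWmem u).1 hu
    exact edgeWeight_eq_zero.1 (hC u' hu').2.2.2 u huC x
      (mem_sdiff.2 ⟨hx, fun h => hxW ((hWmem x).2 ⟨u', hu', hd, h⟩)⟩)
  · intro u hu x hx hxM
    by_contra h
    exact hxM (mem_union_right _ (mem_nbrs.2 ⟨hx, u, hu, by rw [hw]; omega⟩))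
  · intro d hd x hx hxW
    by_contra h
    exact hxW ((hWmem x).2 ⟨x, hx, ⟨d, hd, by rw [hw]; omega⟩, (hC x hx).2.1⟩)
  · intro d hd x hx hxM
    by_contra h
    exact hxM (mem_union_left _ (mem_union_right _ (mem_nbrs.2 ⟨hx, d, hd, by rw [hw]; omega⟩)))
  · intro d hd hdN
    simp only [mem_union, mem_nbrs] at hd
    rcases hd with (hd | ⟨-, x, hx, h⟩) | ⟨-, x, hx, h⟩
    · exact absurd hd hdN
    · exact ⟨x, mem_union_right _ (mem_union_left _ (mem_union_left _ hx)), h⟩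
    · exact ⟨x, mem_union_left _ hx, h⟩

theorem rowWeight_le_of_forall {v : V} {T T' : Finset V} (h : ∀ x ∈ T, x ∉ T' → w v x = 0) :
    rowWeight w v T ≤ rowWeight w v T' := by
  have h1 := rowWeight_add_sdiff (w := w) v (inter_subset_left (s₁ := T) (s₂ := T'))
  have h2 : rowWeight w v (T \ (T ∩ T')) = 0 := rowWeight_eq_zero.2 fun x hx => by
    simp only [mem_sdiff, mem_inter, not_and] at hx
    exact h x hx.1 (hx.2 hx.1)
  have h3 := rowWeight_mono (w := w) v (inter_subset_right (s₁ := T) (s₂ := T'))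
  omega

theorem edgeWeight_le_of_forall {S T T' : Finset V}
    (h : ∀ v ∈ S, ∀ x ∈ T, x ∉ T' → w v x = 0) : edgeWeight w S T ≤ edgeWeight w S T' :=
  sum_le_sum fun v hv => rowWeight_le_of_forall (h v hv)

/-- The exchange inequality obtained by moving `S`, the boundary vertices `N` and the small
components near `N` across a locally optimal cut. -/
theorem card_le_of_locally_optimal [Fintype V] (hw : ∀ u v, w u v = w v u)
    (hdeg : ∀ v, rowWeight w v univ ≤ 3) {k : ℕ} {A D S N : Finset V} (hDA : D ⊆ A)
    (hD : ∀ v ∈ D, rowWeight w v Aᶜ = 1)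
    (hS : S ⊆ (A \ D) \ smallPart w k (A \ D)) (hN : N ⊆ D)
    (hSN : ∀ v ∈ S, ∀ d ∈ D, d ∉ N → w v d = 0)
    (hopt : ∀ T ⊆ A, T.card ≤ S.card + N.card * (12 * k + 4) →
      edgeWeight w T Aᶜ ≤ edgeWeight w T (A \ T)) :
    N.card ≤ edgeWeight w S (((A \ D) \ smallPart w k (A \ D)) \ S) +
      edgeWeight w N (((A \ D) \ smallPart w k (A \ D)) \ S) := by
  obtain ⟨W, hW, M, hM, hNM, hcard, h1, h2, h3, h4, h5⟩ :=
    exists_hull hw hdeg k (R := A \ D) hN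
  have hWR := hW.trans (smallPart_subset (w := w) k (A \ D))
  have hSR := hS.trans sdiff_subset
  set U := smallPart w k (A \ D) with hU
  have hdSW : Disjoint S W := disjoint_left.2 fun x hx hx' => (mem_sdiff.1 (hS hx)).2 (hW hx')
  have hdM : Disjoint (S ∪ W) M := disjoint_left.2 fun x hx hx' => by
    rcases mem_union.1 hx with hx | hx
    · exact (mem_sdiff.1 (hSR hx)).2 (hM hx')
    · exact (mem_sdiff.1 (hWR hx)).2 (hM hx')
  set T := S ∪ W ∪ M with hT
  have hTA : T ⊆ A := union_subset (union_subset (hSR.trans sdiff_subset)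
    (hWR.trans sdiff_subset)) (hM.trans hDA)
  have hTcard : T.card ≤ S.card + N.card * (12 * k + 4) := by
    have : T.card ≤ _ := card_union_le (S ∪ W) M
    have := card_union_le S W
    omega
  have hmain := hopt T hTA hTcard
  have hMA : edgeWeight w M Aᶜ = M.card := by
    rw [edgeWeight, sum_congr rfl fun v hv => hD v (hM hv)]
    simp
  have hMle : M.card ≤ edgeWeight w T Aᶜ := hMA ▸ edgeWeight_mono subset_union_right Subset.rfl
  have hsplit : edgeWeight w T (A \ T) = edgeWeight w S (A \ T) + edgeWeight w W (A \ T) +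
      (edgeWeight w N (A \ T) + edgeWeight w (M \ N) (A \ T)) := by
    rw [edgeWeight_add_sdiff_left hNM, hT, edgeWeight_union_left hdM, edgeWeight_union_left hdSW]
  have hmem : ∀ x ∈ A \ T, x ∉ ((A \ D) \ U) \ S → (x ∈ U ∧ x ∉ W) ∨ (x ∈ D ∧ x ∉ M) := by
    intro x hx hx'
    simp only [hT, mem_sdiff, mem_union] at hx hx'
    tauto
  have eS : edgeWeight w S (A \ T) ≤ edgeWeight w S (((A \ D) \ U) \ S) := by
    refine edgeWeight_le_of_forall fun v hv x hx hx' => ?_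
    rcases hmem x hx hx' with h | h
    · rw [hw]
      exact weight_smallPart_eq_zero h.1 (hS hv)
    · exact hSN v hv x h.1 fun hxN => h.2 (hNM hxN)
  have eN : edgeWeight w N (A \ T) ≤ edgeWeight w N (((A \ D) \ U) \ S) := by
    refine edgeWeight_le_of_forall fun v hv x hx hx' => ?_
    rcases hmem x hx hx' with h | h
    · exact h3 v hv x h.1 h.2
    · exact h4 v hv x h.1 h.2
  have eW : edgeWeight w W (A \ T) = 0 := by
    rw [edgeWeight_eq_zero]
    intro v hv x hx
    simp only [hT, mem_sdiff, mem_union, not_or] at hx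
    by_cases hxD : x ∈ D
    · exact h2 v hv x hxD hx.2.2
    · exact h1 v hv x (by simp [hx, hxD]) hx.2.1.2
  have eM : edgeWeight w (M \ N) (A \ T) ≤ (M \ N).card := by
    rw [card_eq_sum_ones]
    refine sum_le_sum fun d hd => ?_
    rw [mem_sdiff] at hd
    obtain ⟨x, hx, hdx⟩ := h5 d hd.1 hd.2
    have hxT : x ∈ T := by
      simp only [hT, mem_union] at hx ⊢
      tauto
    have e1 := rowWeight_union (w := w) d (disjoint_compl_right (a := A))
    have e2 := rowWeight_add_sdiff (w := w) d hTA
    have e3 := le_rowWeight (w := w) (v := d) hxT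
    have e4 := hD d (hM hd.1)
    have e5 := hdeg d
    rw [union_compl] at e1
    omega
  have := card_sdiff_add_card_eq_card hNM
  omega

/-- A cut that cannot be decreased by moving few vertices of `A` has about at most `1 / 3` as many
edges as `A` has vertices of degree `3`. -/
theorem three_mul_cut_le [Fintype V] (hw : ∀ u v, w u v = w v u)
    (hdeg : ∀ v, rowWeight w v univ = 2 ∨ rowWeight w v univ = 3) {k : ℕ} (hk : 1 ≤ k)
    {A : Finset V} (hopt : ∀ T ⊆ A, T.card ≤ 3 * k + 9 * k * (12 * k + 4) →
      edgeWeight w T Aᶜ ≤ edgeWeight w T (A \ T))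
    (htwo : ∀ v ∈ A, rowWeight w v univ = 2 → rowWeight w v Aᶜ = 0) :
    k * (3 * edgeWeight w A Aᶜ) ≤ k * cubicCount w A + 3 * A.card := by
  have hdeg3 : ∀ v, rowWeight w v univ ≤ 3 := fun v => by have := hdeg v; omega
  have hsplit : ∀ v, rowWeight w v A + rowWeight w v Aᶜ = rowWeight w v univ := fun v => by
    rw [← rowWeight_union v disjoint_compl_right, union_compl]
  have hle1 : ∀ v ∈ A, rowWeight w v Aᶜ ≤ 1 := by
    intro v hv
    have h1 := hopt {v} (singleton_subset_iff.2 hv) (by rw [card_singleton]; nlinarith)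
    simp only [edgeWeight, sum_singleton] at h1
    have h2 := rowWeight_mono (w := w) v (sdiff_subset (s := A) (t := {v}))
    have h3 := hsplit v
    have h4 := hdeg3 v
    omega
  set D := A.filter fun v => rowWeight w v Aᶜ = 1 with hD
  have hDA : D ⊆ A := filter_subset _ _
  have hD1 : ∀ v ∈ D, rowWeight w v Aᶜ = 1 := fun v hv => (mem_filter.1 hv).2
  have hR0 : ∀ v ∈ A \ D, rowWeight w v Aᶜ = 0 := fun v hv => by
    rw [mem_sdiff, hD, mem_filter, not_and] at hv
    have := hle1 v hv.1
    have := hv.2 hv.1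
    omega
  have hD3 : ∀ v ∈ D, rowWeight w v univ = 3 := fun v hv => by
    have h1 := hD1 v hv
    have h2 := htwo v (hDA hv)
    have h3 := hdeg v
    omega
  have hDin : ∀ v ∈ D, rowWeight w v A = 2 := fun v hv => by
    have h1 := hD1 v hv
    have h2 := hD3 v hv
    have h3 := hsplit v
    omega
  have hcut : edgeWeight w A Aᶜ = D.card := by
    rw [← edgeWeight_add_sdiff_left hDA, edgeWeight, sum_congr rfl hD1, edgeWeight,
      sum_congr rfl hR0]
    simp
  have hμ : cubicCount w A = D.card + cubicCount w (A \ D) := by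
    rw [← union_sdiff_of_subset hDA, cubicCount_union disjoint_sdiff, union_sdiff_of_subset hDA,
      cubicCount, filter_true_of_mem hD3]
  set B := (A \ D) \ smallPart w k (A \ D) with hB
  have hBR : B ⊆ A \ D := sdiff_subset
  have hx : ∀ d ∈ D, 1 ≤ rowWeight w d B ∧ rowWeight w d B ≤ 2 := by
    intro d hd
    refine ⟨?_, hDin d hd ▸ rowWeight_mono d (hBR.trans sdiff_subset)⟩
    have := card_le_of_locally_optimal hw hdeg3 (k := k) (S := ∅) (N := {d}) hDA hD1
      (empty_subset _) (singleton_subset_iff.2 hd) (by simp)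
      fun T hT hc => hopt T hT (hc.trans (by simp; nlinarith))
    simpa [edgeWeight] using this
  by_contra! hlt
  rw [hcut, hμ] at hlt
  set f : V → ℤ := fun u =>
    2 - (rowWeight w u univ : ℤ) + ∑ d ∈ D, (w d u : ℤ) * (3 - (rowWeight w d B : ℤ)) with hf
  have hsumf : ∀ S : Finset V, ∑ u ∈ S, f u = 2 * (S.card : ℤ) - (edgeWeight w S univ : ℤ) +
      ∑ d ∈ D, (rowWeight w d S : ℤ) * (3 - (rowWeight w d B : ℤ)) := by
    intro S
    simp only [hf, sum_add_distrib, sum_sub_distrib, edgeWeight, sum_const, nsmul_eq_mul]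
    rw [sum_comm, mul_comm]
    congr 1
    · push_cast
      rfl
    · refine sum_congr rfl fun d _ => ?_
      rw [← sum_mul, rowWeight.eq_def w d S, Nat.cast_sum]
  have hfB : 2 * (D.card : ℤ) - (cubicCount w (A \ D) : ℤ) ≤ ∑ u ∈ B, f u := by
    rw [hsumf, sum_rowWeight_univ hdeg]
    have h1 : (cubicCount w B : ℤ) ≤ cubicCount w (A \ D) := by exact_mod_cast cubicCount_mono hBR
    have h2 : ∑ d ∈ D, (2 : ℤ) ≤
        ∑ d ∈ D, (rowWeight w d B : ℤ) * (3 - (rowWeight w d B : ℤ)) := by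
      refine sum_le_sum fun d hd => ?_
      obtain ⟨h, h'⟩ := hx d hd
      interval_cases rowWeight w d B <;> norm_num
    rw [sum_const, nsmul_eq_mul] at h2
    push_cast
    linarith
  have hsumF : ∀ S : Finset V, ∑ u ∈ S, ((k : ℤ) * f u - 3) = k * ∑ u ∈ S, f u - 3 * S.card := by
    intro S
    rw [sum_sub_distrib, ← mul_sum, sum_const, nsmul_eq_mul, mul_comm (3 : ℤ)]
  have hFB : 0 < ∑ u ∈ B, ((k : ℤ) * f u - 3) := by
    rw [hsumF]
    have h1 : (B.card : ℤ) ≤ A.card := by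
      exact_mod_cast card_le_card (hBR.trans sdiff_subset)
    have h2 := mul_le_mul_of_nonneg_left hfB (Int.natCast_nonneg k)
    zify at hlt
    linarith
  have hBne : B.Nonempty := by
    by_contra h
    rw [not_nonempty_iff_eq_empty] at h
    rw [h] at hFB
    simp at hFB
  obtain ⟨C, hCB, hCne, hCcl, hCconn, hCF⟩ := exists_isConn_sum_nonneg hw _ hBne hFB.le
  obtain ⟨S, hSC, hS, hkS, hSk, hSF⟩ := hCconn.exists_small_sum_nonneg hw hk _
    (fun v _ => (rowWeight_mono v (subset_univ C)).trans (hdeg3 v))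
    (le_card_of_closed hw hCB hCne hCcl) hCF
  have hSB := hSC.trans hCB
  have hf3 : 3 ≤ ∑ u ∈ S, f u := by
    rw [hsumF] at hSF
    by_contra! h
    have h1 : (k : ℤ) ≤ S.card := by exact_mod_cast hkS
    have h2 : (1 : ℤ) ≤ k := by exact_mod_cast hk
    nlinarith
  set N := nbrs w D S with hN
  have hND : N ⊆ D := filter_subset _ _
  have hN0 : ∀ d ∈ D, d ∉ N → rowWeight w d S = 0 := fun d hd hdN => by
    by_contra h
    exact hdN (mem_filter.2 ⟨hd, by omega⟩)
  have hmain := card_le_of_locally_optimal hw hdeg3 (k := k) hDA hD1 hSB hND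
    (fun v hv d hd hdN => by
      rw [hw]
      exact rowWeight_eq_zero.1 (hN0 d hd hdN) v hv)
    fun T hT hc => hopt T hT (hc.trans (by
      have h1 : N.card ≤ 9 * k := (card_nbrs_le hw hdeg3 D S).trans (by omega)
      have h2 := Nat.mul_le_mul_right (12 * k + 4) h1
      omega))
  have hNS : edgeWeight w S D = edgeWeight w N S := by
    rw [edgeWeight_comm hw, ← edgeWeight_add_sdiff_left hND]
    have : edgeWeight w (D \ N) S = 0 := sum_eq_zero fun d hd => by
      rw [mem_sdiff] at hd
      exact hN0 d hd.1 hd.2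
    omega
  have hSuniv : edgeWeight w S univ =
      edgeWeight w S S + edgeWeight w S (B \ S) + edgeWeight w S D := by
    have e1 := edgeWeight_add_sdiff_right (w := w) S (subset_univ A)
    have e2 := edgeWeight_add_sdiff_right (w := w) S hDA
    have e3 := edgeWeight_add_sdiff_right (w := w) S hBR
    have e4 := edgeWeight_add_sdiff_right (w := w) S hSB
    have e5 : edgeWeight w S (univ \ A) = 0 := sum_eq_zero fun v hv => by
      rw [← compl_eq_univ_sdiff]
      exact hR0 v (hBR (hSB hv))
    have e6 : edgeWeight w S ((A \ D) \ B) = 0 := by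
      rw [edgeWeight_eq_zero]
      intro v hv x hx
      rw [hw]
      refine weight_smallPart_eq_zero (k := k) (R := A \ D) ?_ (hSB hv)
      rw [hB, sdiff_sdiff_right_self, inf_eq_inter, mem_inter] at hx
      exact hx.2
    omega
  have hsumN : ∑ d ∈ D, (rowWeight w d S : ℤ) * (3 - (rowWeight w d B : ℤ)) =
      ∑ d ∈ N, (rowWeight w d S : ℤ) * (3 - (rowWeight w d B : ℤ)) :=
    (sum_subset hND fun d hd hdN => by rw [hN0 d hd hdN]; simp).symm
  have hterm : ∑ d ∈ N, (rowWeight w d S : ℤ) * (3 - (rowWeight w d B : ℤ)) ≤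
      ∑ d ∈ N, (1 - (rowWeight w d (B \ S) : ℤ) + (rowWeight w d S : ℤ)) := by
    refine sum_le_sum fun d hd => ?_
    have h1 := hx d (hND hd)
    have h2 := rowWeight_add_sdiff (w := w) d hSB
    have h3 : 0 < rowWeight w d S := (mem_filter.1 hd).2
    obtain ⟨h4, h5⟩ := h1
    have h6 : rowWeight w d S ≤ 2 := by omega
    rw [← h2] at h4 h5 ⊢
    have h7 : rowWeight w d (B \ S) ≤ 1 := by omega
    interval_cases rowWeight w d S <;> interval_cases rowWeight w d (B \ S) <;> norm_num
  have htot := hsumf S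
  rw [hsumN, hSuniv] at htot
  rw [sum_add_distrib, sum_sub_distrib, sum_const, nsmul_eq_mul, mul_one] at hterm
  have hSS := hS.two_mul_card_le hw
  simp only [edgeWeight] at hNS hmain htot hSS
  zify at hNS hmain hSS
  push_cast at htot
  linarith

end LocalCut

/-! ### Balanced cuts -/

section BalancedCut

variable {V : Type*} [DecidableEq V] [Fintype V] {w : V → V → ℕ}

theorem edgeWeight_sdiff_compl (hw : ∀ u v, w u v = w v u) {A S : Finset V} (h : S ⊆ A) :
    edgeWeight w (A \ S) (A \ S)ᶜ + edgeWeight w S Aᶜ =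
      edgeWeight w A Aᶜ + edgeWeight w S (A \ S) := by
  have h1 : (A \ S)ᶜ = Aᶜ ∪ S := by
    ext v
    simp only [mem_compl, mem_sdiff, mem_union]
    tauto
  rw [h1, edgeWeight_union_right _ (disjoint_compl_left.mono_right h),
    ← edgeWeight_add_sdiff_left h Aᶜ, edgeWeight_comm hw S (A \ S)]
  omega

/-- The size of a cut, penalised for an uneven distribution of the vertices of degree `3`. -/
def cutCost (w : V → V → ℕ) (c : ℕ) (A : Finset V) : ℤ :=
  Fintype.card V * edgeWeight w A Aᶜ + c * (2 * cubicCount w A - cubicCount w univ) ^ 2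

theorem cubicCount_compl (A : Finset V) :
    cubicCount w A + cubicCount w Aᶜ = cubicCount w univ := by
  rw [← cubicCount_union disjoint_compl_right, union_compl]

theorem cutCost_compl (hw : ∀ u v, w u v = w v u) (c : ℕ) (A : Finset V) :
    cutCost w c Aᶜ = cutCost w c A := by
  have h := cubicCount_compl (w := w) A
  zify at h
  rw [cutCost, cutCost, compl_compl, edgeWeight_comm hw, ← h]
  ring

theorem exists_minimal_cut (hw : ∀ u v, w u v = w v u) (c : ℕ) :
    ∃ A : Finset V, cubicCount w univ ≤ 2 * cubicCount w A ∧
      (∀ B, cutCost w c A ≤ cutCost w c B) ∧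
      ∀ B, cubicCount w univ ≤ 2 * cubicCount w B → cutCost w c B ≤ cutCost w c A →
        A.card ≤ B.card := by
  classical
  obtain ⟨A₀, hA₀⟩ := Finite.exists_min (cutCost w c)
  have hne : ((univ : Finset (Finset V)).filter fun A =>
      cubicCount w univ ≤ 2 * cubicCount w A ∧ ∀ B, cutCost w c A ≤ cutCost w c B).Nonempty := by
    by_cases h : cubicCount w univ ≤ 2 * cubicCount w A₀
    · exact ⟨A₀, by simpa using ⟨h, hA₀⟩⟩
    · refine ⟨A₀ᶜ, ?_⟩
      rw [mem_filter, cutCost_compl hw]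
      have := cubicCount_compl (w := w) A₀
      exact ⟨mem_univ _, by omega, hA₀⟩
  obtain ⟨A, hA, hmin⟩ := exists_min_image _ Finset.card hne
  simp only [mem_filter, mem_univ, true_and, and_imp] at hA hmin
  exact ⟨A, hA.1, hA.2, fun B hB hBA => hmin B hB fun B' => hBA.trans (hA.2 B')⟩

/-- A sparse cut that nearly bisects the vertices of degree `3`. -/
theorem exists_balanced_cut (hw : ∀ u v, w u v = w v u)
    (hdeg : ∀ v, rowWeight w v univ = 2 ∨ rowWeight w v univ = 3) {k : ℕ} (hk : 1 ≤ k) (c : ℕ)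
    (hcard : 4 * c * (3 * k + 9 * k * (12 * k + 4)) ^ 2 < Fintype.card V) :
    ∃ A : Finset V, k * (3 * edgeWeight w A Aᶜ) ≤ k * cubicCount w A + 3 * A.card ∧
      cubicCount w univ ≤ 2 * cubicCount w A ∧
      4 * c * (2 * cubicCount w A) ≤ 4 * c * cubicCount w univ + 4 * c + 3 * Fintype.card V := by
  obtain ⟨A, hbal, hmin, hmincard⟩ := exists_minimal_cut hw c
  generalize hs : 3 * k + 9 * k * (12 * k + 4) = s at hcard
  have hμ : ∀ S ⊆ A, cubicCount w (A \ S) + cubicCount w S = cubicCount w A := fun S hS => by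
    rw [← cubicCount_union sdiff_disjoint, sdiff_union_of_subset hS]
  refine ⟨A, three_mul_cut_le hw hdeg hk ?_ ?_, hbal, ?_⟩
  · rw [hs]
    intro S hSA hS
    by_contra! hlt
    have h1 := edgeWeight_sdiff_compl hw hSA
    have h2 := hμ S hSA
    have h3 := hmin (A \ S)
    have h4 : cubicCount w S ≤ s := (card_filter_le _ _).trans hS
    have h5 : edgeWeight w (A \ S) (A \ S)ᶜ + 1 ≤ edgeWeight w A Aᶜ := by omega
    have h6 := Nat.mul_le_mul_left (Fintype.card V) h5
    have h7 := Nat.mul_le_mul_left (4 * c) (Nat.pow_le_pow_left h4 2)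
    have h8 := Nat.zero_le (4 * c * ((2 * cubicCount w A - cubicCount w univ) * cubicCount w S))
    simp only [cutCost] at h3
    zify [hbal] at h2 h6 h7 h8 hcard
    rw [← h2] at h3 h8
    nlinarith
  · intro v hv hv2
    by_contra hne
    have hvA : {v} ⊆ A := singleton_subset_iff.2 hv
    have h0 : rowWeight w v A + rowWeight w v Aᶜ = rowWeight w v univ := by
      rw [← rowWeight_union v disjoint_compl_right, union_compl]
    have h1 := edgeWeight_sdiff_compl hw hvA
    have h2 := hμ {v} hvA
    have h3 : cubicCount w {v} = 0 := by
      rw [cubicCount, filter_singleton, if_neg (by omega), card_empty]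
    rw [h3, add_zero] at h2
    have h4 := rowWeight_mono (w := w) v (sdiff_subset (s := A) (t := {v}))
    have h5 : edgeWeight w (A \ {v}) (A \ {v})ᶜ ≤ edgeWeight w A Aᶜ := by
      simp only [edgeWeight, sum_singleton] at h1 ⊢
      omega
    have h6 := hmincard (A \ {v}) (by omega) (by
      rw [cutCost, cutCost, h2]
      gcongr)
    have h7 := card_sdiff_add_card_eq_card hvA
    rw [card_singleton] at h7
    omega
  · rcases le_or_gt (2 * cubicCount w A) (cubicCount w univ + 1) with h | h
    · have := Nat.mul_le_mul_left (4 * c) h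
      rw [mul_add, mul_one] at this
      omega
    obtain ⟨v, hv⟩ : (A.filter fun v => rowWeight w v univ = 3).Nonempty := by
      apply card_pos.1
      change 0 < cubicCount w A
      omega
    rw [mem_filter] at hv
    have hvA : {v} ⊆ A := singleton_subset_iff.2 hv.1
    have h1 := edgeWeight_sdiff_compl hw hvA
    have h2 := hμ {v} hvA
    have h3 : cubicCount w {v} = 1 := by
      rw [cubicCount, filter_singleton, if_pos hv.2, card_singleton]
    rw [h3] at h2
    have h4 := rowWeight_mono (w := w) v (subset_univ (A \ {v}))
    have h5 : edgeWeight w (A \ {v}) (A \ {v})ᶜ ≤ edgeWeight w A Aᶜ + 3 := by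
      simp only [edgeWeight, sum_singleton] at h1 ⊢
      omega
    have h6 := Nat.mul_le_mul_left (Fintype.card V) h5
    have h7 := hmin (A \ {v})
    simp only [cutCost] at h7
    zify at h2 h6 ⊢
    rw [← h2] at h7 ⊢
    nlinarith

end BalancedCut

/-! ### Sweeping across a balanced cut -/

section SweepCut

variable {V : Type*} [DecidableEq V] [Fintype V] {w : V → V → ℕ}

omit [DecidableEq V] [Fintype V] in
theorem weight_eq_zero_of_notMem_nbrs {A T : Finset V} {u v : V} (hu : u ∈ A)
    (hu' : u ∉ nbrs w A T) (hv : v ∈ T) : w u v = 0 := by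
  by_contra h
  exact hu' (mem_nbrs.2 ⟨hu, v, hv, by omega⟩)

/-- The boundary vertices of `A` can be finished one by one. -/
theorem sweep_boundary (hw : ∀ u v, w u v = w v u) (A : Finset V) {B : Finset V}
    (hB : B ⊆ nbrs w A Aᶜ) :
    Sweep w (edgeWeight w A Aᶜ + 1) (A \ nbrs w A Aᶜ, A)
      (A \ nbrs w A Aᶜ ∪ B, A ∪ nbrs w Aᶜ B) := by
  set N := nbrs w A Aᶜ with hN
  have hNA : N ⊆ A := filter_subset _ _
  have hstate : ∀ B ⊆ N, IsState w (A \ N ∪ B, A ∪ nbrs w Aᶜ B) := by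
    refine fun B hB => ⟨union_subset (sdiff_subset.trans subset_union_left)
      ((hB.trans hNA).trans subset_union_left), fun u hu v hv => ?_⟩
    simp only [mem_union, not_or] at hu hv
    have hv' : v ∈ Aᶜ := mem_compl.2 hv.1
    rcases hu with hu | hu
    · rw [mem_sdiff] at hu
      exact weight_eq_zero_of_notMem_nbrs hu.1 hu.2 hv'
    · rw [hw]
      exact weight_eq_zero_of_notMem_nbrs hv' hv.2 hu
  have hcard : ∀ B ⊆ N, ((A ∪ nbrs w Aᶜ B) \ (A \ N ∪ B)).card ≤ edgeWeight w A Aᶜ := by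
    intro B hB
    have h1 : (A ∪ nbrs w Aᶜ B) \ (A \ N ∪ B) ⊆ (N \ B) ∪ nbrs w Aᶜ B := by
      intro x
      simp only [mem_sdiff, mem_union]
      tauto
    have h2 : (N \ B).card ≤ edgeWeight w (N \ B) Aᶜ := by
      rw [card_eq_sum_ones]
      exact sum_le_sum fun v hv => (mem_filter.1 (mem_sdiff.1 hv).1).2
    have h3 : (nbrs w Aᶜ B).card ≤ edgeWeight w B Aᶜ := by
      rw [edgeWeight_comm hw]
      exact card_filter_rowWeight_pos_le _ _
    have h4 := edgeWeight_add_sdiff_left (w := w) hB Aᶜ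
    have h5 := edgeWeight_mono (w := w) hNA (Subset.refl Aᶜ)
    have h6 := (card_le_card h1).trans (card_union_le _ _)
    omega
  induction B using Finset.induction_on with
  | empty =>
    have : nbrs w Aᶜ ∅ = ∅ := by simp [nbrs, rowWeight]
    rw [this, union_empty, union_empty]
    exact .refl
  | insert v B hv ih =>
    have hB' := (subset_insert v B).trans hB
    refine .tail (ih hB') ⟨hstate B hB', hstate _ hB,
      union_subset_union Subset.rfl (subset_insert _ _), union_subset_union Subset.rfl ?_, ?_⟩
    · intro x hx
      obtain ⟨h1, u, hu, h2⟩ := mem_nbrs.1 hx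
      exact mem_nbrs.2 ⟨h1, u, mem_insert_of_mem hu, h2⟩
    · refine (card_le_card (t := insert v ((A ∪ nbrs w Aᶜ (insert v B)) \ (A \ N ∪ insert v B)))
        fun x => ?_).trans ((card_insert_le _ _).trans (Nat.add_le_add_right (hcard _ hB) 1))
      simp only [mem_sdiff, mem_union, mem_insert]
      tauto

theorem sweep_of_cut (hw : ∀ u v, w u v = w v u)
    (hdeg : ∀ v, rowWeight w v univ = 2 ∨ rowWeight w v univ = 3) {k : ℕ} (hk : 1 ≤ k) {K : ℕ}
    {A : Finset V} (hcut : edgeWeight w A Aᶜ ≤ K) (hA : cubicCount w A ≤ 3 * K)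
    (hA' : cubicCount w Aᶜ ≤ 3 * K) :
    Sweep w (K + (Fintype.card V / k + 1) + 3 * k) (∅, ∅) (univ, univ) := by
  set N := nbrs w A Aᶜ with hN
  have hNA : N ⊆ A := filter_subset _ _
  have hNcut : N.card ≤ edgeWeight w A Aᶜ := card_filter_rowWeight_pos_le _ _
  have hinv : ∀ x (S T : Finset V), Disjoint S T → 0 < rowWeight w x S →
      rowWeight w x T ≤ 1 ∨ rowWeight w x univ = 3 := fun x S T hST hS => by
    have h1 := rowWeight_union (w := w) x hST
    have h2 := rowWeight_mono (w := w) x (subset_univ (S ∪ T))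
    have h3 := hdeg x
    omega
  have hst₁ : IsState w (A \ N, A) := ⟨sdiff_subset, fun u hu v hv => by
    rw [mem_sdiff] at hu
    exact weight_eq_zero_of_notMem_nbrs hu.1 hu.2 (mem_compl.2 hv)⟩
  have hst₂ : IsState w (A, A ∪ nbrs w Aᶜ N) := by
    refine ⟨subset_union_left, fun u hu v hv => ?_⟩
    simp only [mem_union, not_or] at hv
    have hv' := mem_compl.2 hv.1
    by_cases huN : u ∈ N
    · rw [hw]
      exact weight_eq_zero_of_notMem_nbrs hv' hv.2 huN
    · exact weight_eq_zero_of_notMem_nbrs hu huN hv'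
  have e₁ : (A \ N)ᶜ \ Aᶜ = N := by
    ext x
    have := @hNA x
    simp only [mem_sdiff, mem_compl]
    tauto
  have e₂ : (A ∪ nbrs w Aᶜ N) \ A = nbrs w Aᶜ N := by
    rw [union_sdiff_left, Finset.sdiff_eq_self_iff_disjoint]
    exact disjoint_compl_left.mono_left (filter_subset _ _)
  have hN'cut : (nbrs w Aᶜ N).card ≤ edgeWeight w A Aᶜ := by
    refine (card_filter_rowWeight_pos_le _ _).trans ?_
    rw [edgeWeight_comm hw]
    exact edgeWeight_mono hNA Subset.rfl
  have hfirst := (sweep_to_univ hw hdeg hk K _ rfl (hst₁.compl hw) (by dsimp only; rw [e₁]; omega)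
    (by simpa using hA) (by
      intro x hx
      dsimp only at hx
      rw [e₁, hN, nbrs, mem_filter] at hx
      refine hinv x Aᶜ _ ?_ hx.2
      rw [compl_compl]
      exact disjoint_compl_left.mono_right sdiff_subset)).compl hw
  simp only [compl_univ, compl_compl] at hfirst
  have hmid := sweep_boundary hw A (Subset.refl N)
  rw [sdiff_union_of_subset hNA] at hmid
  have hlast := sweep_to_univ hw hdeg hk K _ rfl hst₂ (by rw [e₂]; omega) hA' (by
    intro x hx
    rw [e₂, nbrs, mem_filter] at hx
    exact hinv x N _ ((disjoint_compl_right.mono_left hNA).mono_right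
      (compl_subset_compl.2 subset_union_left)) hx.2)
  refine (hfirst.trans (hmid.mono ?_)).trans hlast
  have := Nat.zero_le (Fintype.card V / k)
  omega

end SweepCut

/-- Large graphs with degrees `2` and `3` can be swept with about `M / 6` active vertices, where `M`
is the number of vertices of degree `3`. -/
theorem exists_sweep {ε : ℝ} (hε : 0 < ε) :
    ∃ n₀ : ℕ, ∀ (V : Type*) [Fintype V] [DecidableEq V] (w : V → V → ℕ),
      (∀ u v, w u v = w v u) → (∀ v, rowWeight w v univ = 2 ∨ rowWeight w v univ = 3) →
      n₀ < Fintype.card V →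
      ∃ K : ℕ, (K : ℝ) ≤ (cubicCount w univ : ℝ) / 6 + ε * (Fintype.card V : ℝ) ∧
        Sweep w K (∅, ∅) (univ, univ) := by
  obtain ⟨k, hk⟩ := exists_nat_gt (8 / ε)
  obtain ⟨n₁, hn₁⟩ := exists_nat_gt (2 * (4 + 3 * k) / ε)
  have hkpos : (0 : ℝ) < k := (by positivity : 0 < 8 / ε).trans hk
  have hk1 : 1 ≤ k := by exact_mod_cast hkpos
  refine ⟨max n₁ (4 * k * (3 * k + 9 * k * (12 * k + 4)) ^ 2), fun V _ _ w hw hdeg hn => ?_⟩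
  obtain ⟨A, hcut, hbal, hbal'⟩ :=
    exists_balanced_cut hw hdeg hk1 k ((le_max_right _ _).trans_lt hn)
  have hcompl := cubicCount_compl (w := w) A
  have hAn : A.card ≤ Fintype.card V := card_le_univ A
  generalize hN : Fintype.card V = n at hn hAn hbal'
  have hdiv : n < k * (n / k + 1) := Nat.lt_mul_div_succ n hk1
  have hcutK : edgeWeight w A Aᶜ ≤ cubicCount w A / 3 + n / k + 2 := by
    have h1 : cubicCount w A < 3 * (cubicCount w A / 3 + 1) := Nat.lt_mul_div_succ _ (by norm_num)
    have h2 : k * (3 * edgeWeight w A Aᶜ) ≤ k * (3 * (cubicCount w A / 3 + n / k + 2)) := by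
      have := Nat.mul_le_mul_left k h1.le
      nlinarith
    exact Nat.le_of_mul_le_mul_left (Nat.le_of_mul_le_mul_left h2 hk1) (by norm_num)
  have hμK : cubicCount w A ≤ 3 * (cubicCount w A / 3 + n / k + 2) := by
    have := Nat.zero_le (n / k)
    omega
  refine ⟨_, ?_, sweep_of_cut hw hdeg hk1 hcutK hμK (by omega)⟩
  rw [hN]
  have h1 : ((cubicCount w A / 3 : ℕ) : ℝ) ≤ cubicCount w A / 3 := Nat.cast_div_le
  have h2 : ((n / k : ℕ) : ℝ) ≤ n / k := Nat.cast_div_le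
  have h3 : (n : ℝ) / k ≤ ε * n / 8 := by
    rw [div_lt_iff₀ hε] at hk
    rw [div_le_iff₀ hkpos]
    nlinarith [(Nat.cast_nonneg n : (0 : ℝ) ≤ n)]
  have h4 : 2 * (4 + 3 * (k : ℝ)) ≤ ε * n := by
    rw [div_lt_iff₀ hε] at hn₁
    have : (n₁ : ℝ) ≤ n := by exact_mod_cast ((le_max_left _ _).trans_lt hn).le
    nlinarith
  have h5 : (cubicCount w A : ℝ) ≤ cubicCount w univ / 2 + 1 / 2 + 3 * (n / k) / 8 := by
    have h : (4 * k * (2 * cubicCount w A) : ℝ) ≤ 4 * k * cubicCount w univ + 4 * k + 3 * n := by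
      exact_mod_cast hbal'
    have h' : (n : ℝ) = k * (n / k) := by field_simp
    rw [h'] at h
    have : (k : ℝ) * (8 * cubicCount w A) ≤ k * (4 * cubicCount w univ + 4 + 3 * (n / k)) := by
      linarith
    linarith [le_of_mul_le_mul_left this hkpos]
  push_cast
  linarith

/-! ### From sweeps to path decompositions -/

section PathDecomposition

variable {V : Type*} [DecidableEq V] {w : V → V → ℕ}

theorem Sweep.exists_seq {K : ℕ} {a b : Finset V × Finset V} (h : Sweep w K a b) :
    ∃ (r : ℕ) (f : ℕ → Finset V × Finset V), f 0 = a ∧ f r = b ∧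
      ∀ i < r, SweepStep w K (f i) (f (i + 1)) := by
  induction h with
  | refl => exact ⟨0, fun _ => a, rfl, rfl, by simp⟩
  | @tail b c _ hbc ih =>
    obtain ⟨r, f, h0, hr, hf⟩ := ih
    refine ⟨r + 1, fun i => if i ≤ r then f i else c, by simp [h0], by simp, fun i hi => ?_⟩
    rcases (Nat.lt_succ_iff.1 hi).lt_or_eq with hlt | rfl
    · have h1 : i ≤ r := hlt.le
      have h2 : i + 1 ≤ r := hlt
      simpa [h1, h2] using hf i hlt
    · simpa [hr] using hbc

/-- The active vertices of a sweep form a path decomposition. -/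
theorem Sweep.exists_bags [Fintype V] (hw : ∀ u v, w u v = w v u) {K : ℕ}
    (h : Sweep w K (∅, ∅) (univ, univ)) :
    ∃ (r : ℕ) (X : Fin r → Finset V),
      (∀ u v, (u = v ∨ 0 < w u v) → ∃ t, u ∈ X t ∧ v ∈ X t) ∧
      (∀ (v : V) (t₁ t₂ t₃ : Fin r), t₁ ≤ t₂ → t₂ ≤ t₃ → v ∈ X t₁ → v ∈ X t₃ → v ∈ X t₂) ∧
      ∀ t, (X t).card ≤ K := by
  obtain ⟨r, f, h0, hr, hf⟩ := h.exists_seq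
  have hmono : ∀ i j, i ≤ j → j ≤ r → (f i).1 ⊆ (f j).1 ∧ (f i).2 ⊆ (f j).2 := by
    intro i j hij
    induction j, hij using Nat.le_induction with
    | base => exact fun _ => ⟨Subset.rfl, Subset.rfl⟩
    | succ j _ ih =>
      intro hj
      have h1 := ih (Nat.le_of_succ_le hj)
      have h2 := hf j hj
      exact ⟨h1.1.trans h2.fst_subset, h1.2.trans h2.snd_subset⟩
  refine ⟨r, fun t => (f (t + 1)).2 \ (f t).1, ?_, ?_, fun t => (hf t t.2).card_le⟩
  · intro u v huv
    have hex : ∃ t, u ∈ (f t).2 ∧ v ∈ (f t).2 := ⟨r, by simp [hr]⟩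
    classical
    obtain ⟨hu, hv⟩ := Nat.find_spec hex
    have hmin : ∀ t < Nat.find hex, ¬(u ∈ (f t).2 ∧ v ∈ (f t).2) := fun t => Nat.find_min hex
    have hle : Nat.find hex ≤ r := Nat.find_min' hex (by simp [hr])
    generalize Nat.find hex = s at hu hv hmin hle
    cases s with
    | zero => simp [h0] at hu
    | succ t =>
      have hst := (hf t hle).left
      have hnot := hmin t t.lt_succ_self
      have huP : u ∉ (f t).1 := by
        intro h
        refine hnot ⟨hst.1 h, ?_⟩
        rcases huv with rfl | huv
        · exact hst.1 h
        · by_contra hv'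
          exact huv.ne' (hst.2 u h v hv')
      have hvP : v ∉ (f t).1 := by
        intro h
        refine hnot ⟨?_, hst.1 h⟩
        rcases huv with rfl | huv
        · exact hst.1 h
        · by_contra hu'
          exact huv.ne' (hw u v ▸ hst.2 v h u hu')
      exact ⟨⟨t, hle⟩, mem_sdiff.2 ⟨hu, huP⟩, mem_sdiff.2 ⟨hv, hvP⟩⟩
  · intro v t₁ t₂ t₃ h12 h23 h1 h3
    rw [mem_sdiff] at h1 h3 ⊢
    exact ⟨(hmono _ _ (Nat.succ_le_succ h12) t₂.2).2 h1.1,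
      fun h => h3.2 ((hmono _ _ h23 t₃.2.le).1 h)⟩

/-- A sweep of a graph contracting onto `G` yields a path decomposition of `G`. -/
theorem Sweep.pathwidthAtMost [Fintype V] (hw : ∀ u v, w u v = w v u) {K : ℕ}
    (h : Sweep w K (∅, ∅) (univ, univ)) {U : Type*} {G : SimpleGraph U} {π : V → U}
    (hπ : Function.Surjective π) (hfib : ∀ a b, π a = π b → a = b ∨ 0 < w a b)
    (hadj : ∀ u v, G.Adj u v → ∃ a b, π a = u ∧ π b = v ∧ 0 < w a b) {c : ℝ}
    (hc : (K : ℝ) ≤ c + 1) : PathwidthAtMost G c := by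
  classical
  obtain ⟨r, X, hX, hint, hcard⟩ := h.exists_bags hw
  refine ⟨r, fun t => (X t).image π, ?_, ?_, ?_, fun t => ?_⟩
  · intro v
    obtain ⟨a, rfl⟩ := hπ v
    obtain ⟨t, ht, -⟩ := hX a a (Or.inl rfl)
    exact ⟨t, mem_image_of_mem π ht⟩
  · intro e
    induction e with | _ u v => ?_
    intro he
    obtain ⟨a, b, rfl, rfl, hab⟩ := hadj u v he
    obtain ⟨t, ha, hb⟩ := hX a b (Or.inr hab)
    refine ⟨t, fun x hx => ?_⟩
    rcases Sym2.mem_iff.1 hx with rfl | rfl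
    · exact mem_image_of_mem π ha
    · exact mem_image_of_mem π hb
  · intro v t₁ t₂ t₃ h12 h23 h1 h3
    obtain ⟨a, ha, rfl⟩ := mem_image.1 h1
    obtain ⟨b, hb, hab⟩ := mem_image.1 h3
    obtain ⟨s, hsa, hsb⟩ := hX a b (hfib a b hab.symm)
    rcases le_total t₂ s with hs | hs
    · exact mem_image_of_mem π (hint a _ _ _ h12 hs ha hsa)
    · exact hab ▸ mem_image_of_mem π (hint b _ _ _ hs h23 hsb hb)
  · exact le_trans (by exact_mod_cast card_image_le.trans (hcard t)) hc

end PathDecomposition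

/-! ### Splitting the vertices of degree `4` -/

section Splitting

variable {V Q : Type*} [Fintype V] [DecidableEq V] [Fintype Q]

/-- The vertices obtained by splitting every vertex with four incident half-edges in two. -/
abbrev SplitVertex (p : Q → V) : Type _ := V ⊕ {v : V // #{q | p q = v} = 4}

theorem card_splitVertex_le (p : Q → V) :
    Fintype.card (SplitVertex p) ≤ 2 * Fintype.card V := by
  rw [Fintype.card_sum, two_mul]
  exact Nat.add_le_add_left (Fintype.card_subtype_le _) _

omit [Fintype V] in
theorem exists_splitting (p : Q → V) :
    ∃ σ : Q → SplitVertex p, (∀ q, Sum.elim id Subtype.val (σ q) = p q) ∧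
      (∀ v, #{q | σ q = Sum.inr v} = 2) ∧
      ∀ v, #{q | σ q = Sum.inl v} = if #{q | p q = v} = 4 then 2 else #{q | p q = v} := by
  classical
  have hS : ∀ v, ∃ S ⊆ univ.filter fun q => p q = v,
      S.card = if #{q | p q = v} = 4 then 2 else 0 := fun v =>
    exists_subset_card_eq (by split_ifs <;> omega)
  choose S hS hScard using hS
  have hS4 : ∀ q, q ∈ S (p q) → #{q' | p q' = p q} = 4 := fun q hq => by
    by_contra h
    have := hScard (p q)
    rw [if_neg h, card_eq_zero] at this
    simp [this] at hq
  refine ⟨fun q => if h : q ∈ S (p q) then Sum.inr ⟨p q, hS4 q h⟩ else Sum.inl (p q), ?_, ?_, ?_⟩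
  · intro q
    by_cases h : q ∈ S (p q) <;> simp [h]
  · rintro ⟨v, hv⟩
    have : S v = univ.filter fun q =>
        (if h : q ∈ S (p q) then Sum.inr ⟨p q, hS4 q h⟩ else Sum.inl (p q)) =
          (Sum.inr ⟨v, hv⟩ : SplitVertex p) := by
      ext q
      rw [mem_filter]
      constructor
      · intro hq
        obtain rfl : p q = v := (mem_filter.1 (hS v hq)).2
        simp [hq]
      · rintro ⟨-, hq⟩
        split_ifs at hq with h
        simp only [Sum.inr.injEq, Subtype.mk.injEq] at hq
        exact hq ▸ h
    rw [← this, hScard, if_pos hv]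
  · intro v
    have : (univ.filter fun q => p q = v) \ S v = univ.filter fun q =>
        (if h : q ∈ S (p q) then Sum.inr ⟨p q, hS4 q h⟩ else Sum.inl (p q)) =
          (Sum.inl v : SplitVertex p) := by
      ext q
      rw [mem_filter, mem_sdiff, mem_filter]
      constructor
      · rintro ⟨⟨-, rfl⟩, hq⟩
        simp [hq]
      · rintro ⟨-, hq⟩
        split_ifs at hq with h
        simp only [Sum.inl.injEq] at hq
        exact ⟨⟨mem_univ _, hq⟩, hq ▸ h⟩
    rw [← this, card_sdiff_of_subset (hS v), hScard]
    split_ifs with h <;> omega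

/-- The edges joining the two halves of each split vertex. -/
def halvesWeight (p : Q → V) : SplitVertex p → SplitVertex p → ℕ
  | .inl u, .inr v => if u = v then 1 else 0
  | .inr u, .inl v => if v = u then 1 else 0
  | _, _ => 0

/-- The edge weights after splitting, where `τ` swaps the two half-edges of each edge. -/
def splitWeight {p : Q → V} (σ : Q → SplitVertex p) (τ : Q → Q) (x y : SplitVertex p) : ℕ :=
  #{q | σ q = x ∧ σ (τ q) = y} + halvesWeight p x y

omit [Fintype V] in
theorem splitWeight_comm {p : Q → V} (σ : Q → SplitVertex p) {τ : Q → Q}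
    (hτ : Function.Involutive τ) (x y : SplitVertex p) :
    splitWeight σ τ x y = splitWeight σ τ y x := by
  unfold splitWeight
  congr 1
  · refine card_nbij' τ τ ?_ ?_ ?_ ?_ <;> intro q <;> simp [hτ q] <;> tauto
  · rcases x with x | x <;> rcases y with y | y <;> simp [halvesWeight]

theorem rowWeight_splitWeight {p : Q → V} (σ : Q → SplitVertex p) (τ : Q → Q)
    (x : SplitVertex p) :
    rowWeight (splitWeight σ τ) x univ = #{q | σ q = x} + ∑ y, halvesWeight p x y := by
  unfold rowWeight splitWeight
  rw [sum_add_distrib]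
  congr 1
  rw [card_eq_sum_card_fiberwise (f := fun q => σ (τ q)) (t := univ) (by simp)]
  simp only [filter_filter]

theorem sum_halvesWeight_inl (p : Q → V) (v : V) :
    ∑ y, halvesWeight p (.inl v) y = if #{q | p q = v} = 4 then 1 else 0 := by
  rw [Fintype.sum_sum_type]
  simp only [halvesWeight, sum_const_zero, zero_add]
  rw [← card_filter]
  split_ifs with h
  · rw [card_eq_one]
    exact ⟨⟨v, h⟩, by ext ⟨x, hx⟩; simp [eq_comm]⟩
  · rw [card_eq_zero, filter_eq_empty_iff]
    rintro ⟨x, hx⟩ - rfl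
    exact h hx

theorem sum_halvesWeight_inr (p : Q → V) (v : {v : V // #{q | p q = v} = 4}) :
    ∑ y, halvesWeight p (.inr v) y = 1 := by
  rw [Fintype.sum_sum_type]
  simp [halvesWeight]

theorem rowWeight_splitWeight_eq {p : Q → V} {σ : Q → SplitVertex p} (τ : Q → Q)
    (hdeg : ∀ v, 2 ≤ #{q | p q = v}) (hdeg' : ∀ v, #{q | p q = v} ≤ 4)
    (hinr : ∀ v, #{q | σ q = Sum.inr v} = 2)
    (hinl : ∀ v, #{q | σ q = Sum.inl v} = if #{q | p q = v} = 4 then 2 else #{q | p q = v})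
    (x : SplitVertex p) : rowWeight (splitWeight σ τ) x univ = 2 ∨
      rowWeight (splitWeight σ τ) x univ = 3 := by
  rw [rowWeight_splitWeight]
  rcases x with v | v
  · rw [hinl, sum_halvesWeight_inl]
    have h1 := hdeg v
    have h2 := hdeg' v
    split_ifs <;> omega
  · rw [hinr, sum_halvesWeight_inr]
    exact Or.inr rfl

theorem cubicCount_splitWeight {p : Q → V} {σ : Q → SplitVertex p} (τ : Q → Q)
    (hdeg : ∀ x, rowWeight (splitWeight σ τ) x univ = 2 ∨
      rowWeight (splitWeight σ τ) x univ = 3) :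
    cubicCount (splitWeight σ τ) univ + 2 * Fintype.card V = Fintype.card Q := by
  have h := sum_rowWeight_univ hdeg univ
  have h1 : edgeWeight (splitWeight σ τ) univ univ =
      Fintype.card Q + 2 * Fintype.card {v : V // #{q | p q = v} = 4} := by
    unfold edgeWeight
    simp only [rowWeight_splitWeight, sum_add_distrib]
    rw [← card_eq_sum_card_fiberwise (f := σ) (t := univ) (by simp), Fintype.sum_sum_type]
    simp only [sum_halvesWeight_inl, sum_halvesWeight_inr]
    rw [← card_filter, ← Fintype.card_subtype, sum_const, smul_eq_mul, mul_one, card_univ,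
      card_univ]
    omega
  rw [h1, card_univ, Fintype.card_sum] at h
  omega

end Splitting

/-- The vertex at a half-edge; the two half-edges of an edge are swapped by `Sum.swap`. -/
def halfEdgeVertex {V E : Type*} (ends : E → V × V) : E ⊕ E → V :=
  Sum.elim (fun e => (ends e).1) fun e => (ends e).2

theorem mdeg_eq_card {V E : Type*} [Fintype E] [DecidableEq V] (ends : E → V × V) (v : V) :
    mdeg ends v = #{q | halfEdgeVertex ends q = v} := by
  rw [mdeg, Nat.card_eq_fintype_card, Nat.card_eq_fintype_card, Fintype.card_subtype,
    Fintype.card_subtype, card_filter, card_filter, card_filter, Fintype.sum_sum_type]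
  rfl

theorem exists_halfEdge {V E : Type*} {ends : E → V × V} {u v : V}
    (h : (underlyingSimple ends).Adj u v) :
    ∃ q, halfEdgeVertex ends q = u ∧ halfEdgeVertex ends q.swap = v := by
  rw [underlyingSimple, SimpleGraph.fromRel_adj] at h
  obtain ⟨-, ⟨e, he | he⟩ | ⟨e, he | he⟩⟩ := h
  · exact ⟨.inl e, by simp [halfEdgeVertex, he]⟩
  · exact ⟨.inr e, by simp [halfEdgeVertex, he]⟩
  · exact ⟨.inr e, by simp [halfEdgeVertex, he]⟩
  · exact ⟨.inl e, by simp [halfEdgeVertex, he]⟩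

end PathwidthBound

open PathwidthBound

/-- For every `ε > 0` there is an integer `n_ε` such that every
multigraph with `n > n_ε` vertices and `m` edges, all of whose degrees are between
2 and 4, has pathwidth at most `(m − n)/3 + ε·n`. -/
theorem stmt_4 (ε : ℝ) (hε : 0 < ε) :
    ∃ nε : ℕ, ∀ (V E : Type) [Fintype V] [Fintype E], ∀ ends : E → V × V,
      nε < Fintype.card V →
      (∀ v, 2 ≤ mdeg ends v) → (∀ v, mdeg ends v ≤ 4) →
      PathwidthAtMost (underlyingSimple ends)
        (((Fintype.card E : ℝ) - (Fintype.card V : ℝ)) / 3 + ε * (Fintype.card V : ℝ)) := by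
  classical
  obtain ⟨n₀, hn₀⟩ := exists_sweep (half_pos hε)
  refine ⟨n₀, fun V E _ _ ends hn hdeg hdeg' => ?_⟩
  simp only [mdeg_eq_card] at hdeg hdeg'
  obtain ⟨σ, hσ, hinr, hinl⟩ := exists_splitting (halfEdgeVertex ends)
  have hrow := rowWeight_splitWeight_eq Sum.swap hdeg hdeg' hinr hinl
  have hcubic := cubicCount_splitWeight Sum.swap hrow
  have hsymm := splitWeight_comm σ (τ := Sum.swap) Sum.swap_swap
  have hcard := card_splitVertex_le (halfEdgeVertex ends)
  obtain ⟨K, hK, hsweep⟩ := hn₀ _ _ hsymm hrow (by rw [Fintype.card_sum]; omega)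
  refine hsweep.pathwidthAtMost hsymm (π := Sum.elim id Subtype.val) (fun v => ⟨.inl v, rfl⟩)
    ?_ (fun u v huv => ?_) ?_
  · rintro (a | a) (b | b) h
    · exact Or.inl (congrArg Sum.inl h)
    · have h : a = b.1 := h
      exact Or.inr (Nat.add_pos_right _ (by simp [halvesWeight, h]))
    · have h : a.1 = b := h
      exact Or.inr (Nat.add_pos_right _ (by simp [halvesWeight, h]))
    · exact Or.inl (congrArg Sum.inr (Subtype.ext h))
  · obtain ⟨q, hu, hv⟩ := exists_halfEdge huv
    exact ⟨σ q, σ q.swap, (hσ q).trans hu, (hσ q.swap).trans hv,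
      Nat.add_pos_left (Finset.card_pos.2 ⟨q, by simp⟩) _⟩
  · have h1 := congrArg (Nat.cast (R := ℝ)) hcubic
    have h2 : (Fintype.card (SplitVertex (halfEdgeVertex ends)) : ℝ) ≤ 2 * Fintype.card V := by
      exact_mod_cast hcard
    rw [Fintype.card_sum] at h1
    push_cast at h1
    have h3 := mul_le_mul_of_nonneg_left h2 (half_pos hε).le
    linarith
end
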